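/- arXiv:1003.5844 — 9 statements merged into one kernel-verified Lean document; each statement's English description precedes it below -/
import Mathlib

section
/- Let b : ℝ × ℝ → ℝ be a bounded measurable function such that for each fixed first argument x' ∈ ℝ, the map y ↦ b(x',y) is strictly increasing on {y ∈ ℝ : y ≥ x'}, and let x ∈ ℝ. Suppose (X, W) and (X̃, W̃) are two weak solutions of the equation X_t = x + W_t + ∫_0^t b(X_s, sup_{0≤u≤s} X_u) ds, defined on (possibly different) filtered probability spaces, where W and W̃ are standard Brownian motions. Then X and X̃ have the same finite-dimensional distributions: for all n and all times 0 ≤ t₁ < ⋯ < tₙ, the random vectors (X_{t₁},…,X_{tₙ}) and (X̃_{t₁},…,X̃_{tₙ}) have the same law. -/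
open Set MeasureTheory ProbabilityTheory

/-- A standard one-dimensional Brownian motion `W` on a filtered probability space:
continuous paths, `W 0 = 0`, adapted, and for `0 ≤ s ≤ t` the increment `W t - W s`
is independent of `ℱ s` and has Gaussian law `N(0, t - s)`. -/
def IsStandardBrownianMotion {Ω : Type*} {m : MeasurableSpace Ω}
    (P : Measure Ω) (ℱ : Filtration ℝ m) (W : ℝ → Ω → ℝ) : Prop :=
  (∀ ω, Continuous fun t => W t ω) ∧
  (∀ ω, W 0 ω = 0) ∧
  Adapted ℱ W ∧
  (∀ s t : ℝ, 0 ≤ s → s ≤ t →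
    Indep (MeasurableSpace.comap (fun ω => W t ω - W s ω) Real.measurableSpace)
      (ℱ s) P) ∧
  (∀ s t : ℝ, 0 ≤ s → s ≤ t →
    P.map (fun ω => W t ω - W s ω) = gaussianReal 0 (Real.toNNReal (t - s)))

/-- A weak solution of `X_t = x + W_t + ∫_0^t b(X_s, max_{0≤u≤s} X_u) ds` on a filtered
probability space: `X` is continuous and adapted, `W` is an adapted standard Brownian
motion, and the equation holds almost surely for all `t ≥ 0`. -/
def IsWeakSolutionMaxDrift {Ω : Type*} {m : MeasurableSpace Ω}
    (P : Measure Ω) (ℱ : Filtration ℝ m) (x : ℝ) (b : ℝ → ℝ → ℝ)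
    (X W : ℝ → Ω → ℝ) : Prop :=
  (∀ ω, Continuous fun t => X t ω) ∧
  Adapted ℱ X ∧
  IsStandardBrownianMotion P ℱ W ∧
  (∀ᵐ ω ∂P, ∀ t : ℝ, 0 ≤ t →
    X t ω = x + W t ω +
      ∫ s in (0:ℝ)..t, b (X s ω) (sSup ((fun u => X u ω) '' Set.Icc 0 s)))

open Filter Topology
open scoped NNReal ENNReal

lemma integral_cexp_gaussianReal_shift (v : ℝ≥0) (α η : ℝ) :
    ∫ z, Complex.exp (-α * z - α ^ 2 * v / 2 + Complex.I * η * (z + α * v)) ∂(gaussianReal 0 v)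
      = Complex.exp (-(v * η ^ 2 / 2)) := by
  have h := complexMGF_gaussianReal (p := gaussianReal 0 v) (X := id) (μ := 0) (v := v)
    (by simp) (-α + Complex.I * η)
  simp only [complexMGF, id] at h
  have e : ∀ z : ℝ, Complex.exp (-α * z - α ^ 2 * v / 2 + Complex.I * η * (z + α * v))
      = Complex.exp ((-α + Complex.I * η) * z)
        * Complex.exp (- α ^ 2 * v / 2 + Complex.I * η * (α * v)) := fun z => by
    rw [← Complex.exp_add]; congr 1; ring
  simp_rw [e]
  rw [integral_mul_const, h, ← Complex.exp_add]
  congr 1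
  push_cast
  linear_combination (v * η ^ 2 / 2 : ℂ) * Complex.I_sq

lemma integral_mul_girsanov_factor {Ω : Type*} {𝒢 m₀ : MeasurableSpace Ω} {P : Measure Ω}
    [IsProbabilityMeasure P] (h𝒢 : 𝒢 ≤ m₀) {ξ : Ω → ℝ} {v : ℝ≥0}
    (hξ : Measurable ξ)
    (hind : Indep (MeasurableSpace.comap ξ Real.measurableSpace) 𝒢 P)
    (hlaw : P.map ξ = gaussianReal 0 v)
    {a : Ω → ℝ} (ha : Measurable[𝒢] a) {C : ℝ} (haC : ∀ ω, |a ω| ≤ C)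
    {Y : Ω → ℂ} (hY : Measurable[𝒢] Y) (hYi : Integrable Y P) (η : ℝ) :
    Integrable (fun ω => Y ω * Complex.exp (-a ω * ξ ω - (a ω) ^ 2 * v / 2
      + Complex.I * η * (ξ ω + a ω * v))) P ∧
    ∫ ω, Y ω * Complex.exp (-a ω * ξ ω - (a ω) ^ 2 * v / 2
      + Complex.I * η * (ξ ω + a ω * v)) ∂P = Complex.exp (-(v * η ^ 2 / 2)) * ∫ ω, Y ω ∂P := by
  have ha' : Measurable a := ha.mono h𝒢 le_rfl
  have hY' : Measurable Y := hY.mono h𝒢 le_rfl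
  have hpair : Measurable[𝒢] fun ω => (Y ω, a ω) := hY.prodMk ha
  have hpair' : Measurable fun ω => (Y ω, a ω) := hY'.prodMk ha'
  have hI : IndepFun (fun ω => (Y ω, a ω)) ξ P :=
    indep_of_indep_of_le_left hind.symm hpair.comap_le
  have hmap := (indepFun_iff_map_prod_eq_prod_map_map hpair'.aemeasurable hξ.aemeasurable).1 hI
  let F : (ℂ × ℝ) × ℝ → ℂ := fun p => p.1.1 * Complex.exp (-p.1.2 * p.2 - (p.1.2) ^ 2 * v / 2
      + Complex.I * η * (p.2 + p.1.2 * v))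
  have hF : Measurable F := by fun_prop
  have hC : 0 ≤ C := (abs_nonneg _).trans (haC (Classical.choice P.nonempty_of_neZero))
  have hint : Integrable (fun ω => F ((Y ω, a ω), ξ ω)) P := by
    have hexp : Integrable (fun ω => Real.exp (C * |ξ ω|)) P := by
      refine integrable_exp_mul_abs ?_ ?_ <;>
      · have := integrable_exp_mul_gaussianReal (μ := 0) (v := v)
        rw [← hlaw] at this
        exact (integrable_map_measure (by fun_prop) hξ.aemeasurable).1 (this _)
    have hIY : IndepFun (fun ω => ‖Y ω‖) (fun ω => Real.exp (C * |ξ ω|)) P :=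
      hI.comp (φ := fun p : ℂ × ℝ => ‖p.1‖) (ψ := fun z => Real.exp (C * |z|)) (by fun_prop) (by fun_prop)
    refine (hIY.integrable_mul hYi.norm hexp).mono'
      (hF.comp (hpair'.prodMk hξ)).aestronglyMeasurable (ae_of_all _ fun ω => ?_)
    simp only [F, norm_mul, Pi.mul_apply, Complex.norm_exp]
    gcongr
    have h1 : -(a ω * ξ ω) ≤ C * |ξ ω| := by
      calc -(a ω * ξ ω) ≤ |a ω * ξ ω| := neg_le_abs _
        _ = |a ω| * |ξ ω| := abs_mul _ _
        _ ≤ _ := by gcongr; exact haC ω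
    have h2 : 0 ≤ (a ω) ^ 2 * v / 2 := by positivity
    have h3 : (-(a ω : ℂ) * ξ ω - (a ω) ^ 2 * v / 2 + Complex.I * η * (ξ ω + a ω * v)).re
        = -(a ω * ξ ω) - (a ω) ^ 2 * v / 2 := by
      have : (-(a ω : ℂ) * ξ ω - (a ω) ^ 2 * v / 2 + Complex.I * η * (ξ ω + a ω * v))
        = ((-(a ω * ξ ω) - (a ω) ^ 2 * v / 2 : ℝ) : ℂ)
          + ((η * (ξ ω + a ω * v) : ℝ) : ℂ) * Complex.I := by push_cast; ring
      rw [this, Complex.add_re, Complex.re_ofReal_mul, Complex.I_re, Complex.ofReal_re]; simp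
    rw [h3]; linarith
  refine ⟨hint, ?_⟩
  have hF2 : Integrable F ((P.map fun ω => (Y ω, a ω)).prod (P.map ξ)) := by
    rw [← hmap]
    exact (integrable_map_measure hF.aestronglyMeasurable (hpair'.prodMk hξ).aemeasurable).2 hint
  have : IsProbabilityMeasure (P.map ξ) := Measure.isProbabilityMeasure_map hξ.aemeasurable
  have : IsProbabilityMeasure (P.map fun ω => (Y ω, a ω)) :=
    Measure.isProbabilityMeasure_map hpair'.aemeasurable
  calc ∫ ω, F ((Y ω, a ω), ξ ω) ∂P
      = ∫ p, F p ∂(P.map fun ω => ((Y ω, a ω), ξ ω)) :=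
        (integral_map (hpair'.prodMk hξ).aemeasurable hF.aestronglyMeasurable).symm
    _ = ∫ q, ∫ z, F (q, z) ∂(P.map ξ) ∂(P.map fun ω => (Y ω, a ω)) := by
        rw [hmap, integral_prod _ hF2]
    _ = ∫ q, q.1 * Complex.exp (-(v * η ^ 2 / 2)) ∂(P.map fun ω => (Y ω, a ω)) := by
        congr 1; ext q
        simp only [F]
        rw [integral_const_mul, hlaw, integral_cexp_gaussianReal_shift]
    _ = ∫ ω, Y ω * Complex.exp (-(v * η ^ 2 / 2)) ∂P :=
        integral_map hpair'.aemeasurable (by fun_prop)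
    _ = _ := by rw [integral_mul_const, mul_comm]

section Discrete

variable {Ω : Type*} {m₀ : MeasurableSpace Ω} {P : Measure Ω} [IsProbabilityMeasure P]

/-- `ξ 0, …, ξ (K - 1)` are centred Gaussian variables of variance `v`, each independent of
the past described by the increasing family `G`. -/
structure GaussianIncrements (P : Measure Ω) (G : ℕ → MeasurableSpace Ω) (K : ℕ) (v : ℝ≥0)
    (ξ : ℕ → Ω → ℝ) : Prop where
  mono : Monotone G
  le : ∀ k, G k ≤ m₀
  meas : ∀ k < K, Measurable[G (k + 1)] (ξ k)
  indep : ∀ k < K, Indep (MeasurableSpace.comap (ξ k) Real.measurableSpace) (G k) P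
  law : ∀ k < K, P.map (ξ k) = gaussianReal 0 v

namespace GaussianIncrements

variable {G : ℕ → MeasurableSpace Ω} {K : ℕ} {v : ℝ≥0} {ξ : ℕ → Ω → ℝ} {a : ℕ → Ω → ℝ} {C : ℝ}

lemma measurable_cexp_sum {P : Measure Ω} (hG : GaussianIncrements P G K v ξ) (ha : ∀ k < K, Measurable[G k] (a k))
    (η : ℕ → ℝ) {k : ℕ} (hk : k ≤ K) :
    Measurable[G k] fun ω => Complex.exp (∑ i ∈ Finset.range k,
      (-a i ω * ξ i ω - (a i ω) ^ 2 * v / 2 + Complex.I * η i * (ξ i ω + a i ω * v))) := by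
  refine Complex.measurable_exp.comp (Finset.measurable_sum _ fun i hi => ?_)
  have hik : i < k := Finset.mem_range.1 hi
  have h1 : Measurable[G k] (ξ i) := (hG.meas i (hik.trans_le hk)).mono (hG.mono hik) le_rfl
  have h2 : Measurable[G k] (a i) := (ha i (hik.trans_le hk)).mono (hG.mono hik.le) le_rfl
  fun_prop

lemma integral_girsanov (hG : GaussianIncrements P G K v ξ) (ha : ∀ k < K, Measurable[G k] (a k))
    (haC : ∀ k ω, |a k ω| ≤ C) (η : ℕ → ℝ) {k : ℕ} (hk : k ≤ K) :
    Integrable (fun ω => Complex.exp (∑ i ∈ Finset.range k,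
      (-a i ω * ξ i ω - (a i ω) ^ 2 * v / 2 + Complex.I * η i * (ξ i ω + a i ω * v)))) P ∧
    ∫ ω, Complex.exp (∑ i ∈ Finset.range k,
      (-a i ω * ξ i ω - (a i ω) ^ 2 * v / 2 + Complex.I * η i * (ξ i ω + a i ω * v))) ∂P
      = Complex.exp (-∑ i ∈ Finset.range k, (v * η i ^ 2 / 2 : ℂ)) := by
  induction k with
  | zero => simp
  | succ k ih =>
    obtain ⟨h1, h2⟩ := ih (by omega)
    have hk' : k < K := hk
    have hstep := integral_mul_girsanov_factor (hG.le k)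
      ((hG.meas k hk').mono (hG.le _) le_rfl) (hG.indep k hk') (hG.law k hk') (ha k hk') (haC k)
      (hG.measurable_cexp_sum ha η hk'.le) h1 (η k)
    simp_rw [Finset.sum_range_succ, Complex.exp_add (Finset.sum _ _)]
    refine ⟨hstep.1, ?_⟩
    rw [hstep.2, h2, neg_add, Complex.exp_add, mul_comm]

/-- Discrete Itô isometry. -/
lemma integral_sum_mul_sq (hG : GaussianIncrements P G K v ξ) (ha : ∀ k < K, Measurable[G k] (a k))
    (haC : ∀ k ω, |a k ω| ≤ C) {k : ℕ} (hk : k ≤ K) :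
    MemLp (fun ω => ∑ i ∈ Finset.range k, a i ω * ξ i ω) 2 P ∧
    ∫ ω, (∑ i ∈ Finset.range k, a i ω * ξ i ω) ^ 2 ∂P
      = ∫ ω, ∑ i ∈ Finset.range k, v * (a i ω) ^ 2 ∂P := by
  induction k with
  | zero => simp
  | succ k ih =>
    obtain ⟨h1, h2⟩ := ih (by omega)
    have hk' : k < K := hk
    have hξm : Measurable (ξ k) := (hG.meas k hk').mono (hG.le _) le_rfl
    have ham : ∀ i < K, Measurable (a i) := fun i hi => (ha i hi).mono (hG.le _) le_rfl
    have hξ2 : MemLp (ξ k) 2 P := by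
      have := memLp_id_gaussianReal' (μ := 0) (v := v) 2 (by simp)
      rw [← hG.law k hk'] at this
      exact (memLp_map_measure_iff (by fun_prop) hξm.aemeasurable).1 this
    have hmean : ∫ ω, ξ k ω ∂P = 0 := by
      rw [← integral_map (f := fun x => x) hξm.aemeasurable (by fun_prop), hG.law k hk']
      simp
    have hvar : ∫ ω, (ξ k ω) ^ 2 ∂P = v := by
      rw [← integral_map (f := fun x => x ^ 2) hξm.aemeasurable (by fun_prop), hG.law k hk']
      have := variance_fun_id_gaussianReal (μ := 0) (v := v)
      rwa [variance_of_integral_eq_zero (by fun_prop) (by simp)] at this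
    have hasm : AEStronglyMeasurable (a k) P := (ham k hk').aestronglyMeasurable
    have haξ : MemLp (fun ω => a k ω * ξ k ω) 2 P := by
      have hb := MemLp.of_bound (p := ∞) hasm C (ae_of_all _ (haC k))
      exact hξ2.mul' hb
    have hS : Measurable[G k] fun ω => ∑ i ∈ Finset.range k, a i ω * ξ i ω := by
      refine Finset.measurable_sum _ fun i hi => ?_
      have hik : i < k := Finset.mem_range.1 hi
      have h1 : Measurable[G k] (ξ i) := (hG.meas i (hik.trans hk)).mono (hG.mono hik) le_rfl
      have h2 : Measurable[G k] (a i) := (ha i (hik.trans hk)).mono (hG.mono hik.le) le_rfl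
      exact h2.mul h1
    have hI1 : IndepFun (fun ω => (∑ i ∈ Finset.range k, a i ω * ξ i ω) * a k ω) (ξ k) P :=
      indep_of_indep_of_le_left (hG.indep k hk').symm (hS.mul (ha k hk')).comap_le
    have hI2 : IndepFun (fun ω => (a k ω) ^ 2) (fun ω => (ξ k ω) ^ 2) P :=
      (show IndepFun (a k) (ξ k) P from
        indep_of_indep_of_le_left (hG.indep k hk').symm (ha k hk').comap_le).comp
        (φ := fun x => x ^ 2) (ψ := fun x => x ^ 2) (by fun_prop) (by fun_prop)
    simp_rw [Finset.sum_range_succ]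
    refine ⟨h1.add haξ, ?_⟩
    have e : ∀ ω, ((∑ i ∈ Finset.range k, a i ω * ξ i ω) + a k ω * ξ k ω) ^ 2
        = (∑ i ∈ Finset.range k, a i ω * ξ i ω) ^ 2
          + 2 * ((∑ i ∈ Finset.range k, a i ω * ξ i ω) * (a k ω * ξ k ω))
          + (a k ω * ξ k ω) ^ 2 := fun ω => by ring
    have hcross : ∫ ω, (∑ i ∈ Finset.range k, a i ω * ξ i ω) * (a k ω * ξ k ω) ∂P = 0 := by
      have := hI1.integral_fun_mul_eq_mul_integral
        ((hS.mul (ha k hk')).mono (hG.le k) le_rfl).aestronglyMeasurable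
        hξm.aestronglyMeasurable
      simp_rw [← mul_assoc]
      rw [this, hmean, mul_zero]
    have hsq : ∫ ω, (a k ω * ξ k ω) ^ 2 ∂P = ∫ ω, v * (a k ω) ^ 2 ∂P := by
      simp_rw [mul_pow]
      rw [hI2.integral_fun_mul_eq_mul_integral (by fun_prop) (by fun_prop), hvar,
        integral_const_mul, mul_comm]
    have hai : ∀ i < K, Integrable (fun ω => v * (a i ω) ^ 2) P := fun i hi =>
      Integrable.of_bound (by have := ham i hi; fun_prop) (v * C ^ 2) (ae_of_all _ fun ω => by
        rw [norm_mul, Real.norm_of_nonneg (NNReal.coe_nonneg v), norm_pow, Real.norm_eq_abs]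
        have := haC i ω
        gcongr)
    simp_rw [e]
    rw [integral_add _ haξ.integrable_sq, integral_add h1.integrable_sq, integral_const_mul,
      hcross, hsq, h2, integral_add _ (hai k hk')]
    · ring
    · exact integrable_finsetSum _ fun i hi => hai i (by have := Finset.mem_range.1 hi; omega)
    · exact (h1.integrable_mul haξ).const_mul 2
    · exact h1.integrable_sq.add ((h1.integrable_mul haξ).const_mul 2)

/-- Second moment bound for the discrete Girsanov density. -/
lemma lintegral_girsanov_sq_le (hG : GaussianIncrements P G K v ξ)
    (ha : ∀ k < K, Measurable[G k] (a k)) (haC : ∀ k ω, |a k ω| ≤ C) :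
    ∫⁻ ω, ENNReal.ofReal (Real.exp (-∑ i ∈ Finset.range K, a i ω * ξ i ω
      - (∑ i ∈ Finset.range K, v * (a i ω) ^ 2) / 2) ^ 2) ∂P
      ≤ ENNReal.ofReal (Real.exp (K * (v * C ^ 2))) := by
  have h2a : ∀ k < K, Measurable[G k] (fun ω => 2 * a k ω) := fun k hk => (ha k hk).const_mul 2
  obtain ⟨h1, h2⟩ := hG.integral_girsanov h2a (C := 2 * C)
    (fun k ω => by rw [abs_mul, abs_two]; have := haC k ω; gcongr) (fun _ => 0) le_rfl
  have e : ∀ ω, Complex.exp (∑ i ∈ Finset.range K, (-((2 * a i ω : ℝ) : ℂ) * ξ i ω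
      - ((2 * a i ω : ℝ) : ℂ) ^ 2 * v / 2
        + Complex.I * ((fun _ => 0 : ℕ → ℝ) i) * (ξ i ω + ((2 * a i ω : ℝ) : ℂ) * v)))
      = ((Real.exp (∑ i ∈ Finset.range K,
          (-(2 * a i ω) * ξ i ω - (2 * a i ω) ^ 2 * v / 2)) : ℝ) : ℂ) := fun ω => by
    push_cast; simp
  simp_rw [e] at h1 h2
  have h1' := h1.re
  simp only [RCLike.re_to_complex, Complex.ofReal_re] at h1'
  rw [integral_complex_ofReal] at h2
  have h3 : ∫ ω, Real.exp (∑ i ∈ Finset.range K,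
          (-(2 * a i ω) * ξ i ω - (2 * a i ω) ^ 2 * v / 2)) ∂P = 1 := by
    have : ((1 : ℝ) : ℂ) = Complex.exp (-∑ i ∈ Finset.range K,
      (v * ((fun _ => 0 : ℕ → ℝ) i : ℂ) ^ 2 / 2 : ℂ)) := by simp
    rw [← this] at h2
    exact_mod_cast h2
  calc _ ≤ ∫⁻ ω, ENNReal.ofReal (Real.exp (K * (v * C ^ 2))) * ENNReal.ofReal
        (Real.exp (∑ i ∈ Finset.range K,
          (-(2 * a i ω) * ξ i ω - (2 * a i ω) ^ 2 * v / 2))) ∂P := by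
        refine lintegral_mono fun ω => ?_
        rw [← ENNReal.ofReal_mul (Real.exp_nonneg _), ← Real.exp_add, ← Real.exp_nat_mul]
        refine ENNReal.ofReal_le_ofReal (Real.exp_le_exp.2 ?_)
        have hb : ∑ i ∈ Finset.range K, v * (a i ω) ^ 2 ≤ K * (v * C ^ 2) := by
          calc _ ≤ ∑ i ∈ Finset.range K, (v * C ^ 2 : ℝ) := by
                refine Finset.sum_le_sum fun i _ => ?_
                have := sq_le_sq' (neg_le_of_abs_le (haC i ω)) (le_of_abs_le (haC i ω))
                gcongr
            _ = _ := by simp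
        have hs : ∑ i ∈ Finset.range K, (-(2 * a i ω) * ξ i ω - (2 * a i ω) ^ 2 * v / 2)
            = -2 * ∑ i ∈ Finset.range K, a i ω * ξ i ω
              - 2 * ∑ i ∈ Finset.range K, v * (a i ω) ^ 2 := by
          rw [Finset.mul_sum, Finset.mul_sum, ← Finset.sum_sub_distrib]
          exact Finset.sum_congr rfl fun i _ => by ring
        rw [hs]; push_cast; linarith
    _ = ENNReal.ofReal (Real.exp (K * (v * C ^ 2))) := by
        rw [lintegral_const_mul' _ _ ENNReal.ofReal_ne_top,
          ← ofReal_integral_eq_lintegral_ofReal h1' (ae_of_all _ fun ω => Real.exp_nonneg _), h3]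
        simp

end GaussianIncrements
end Discrete

section Convergence

variable {S : Type*} {mS : MeasurableSpace S} {μ : Measure S}

lemma exists_subseq_ae_tendsto_of_integral_sq_le {f : ℕ → S → ℝ} (hf : ∀ n, MemLp (f n) 2 μ)
    {δ : ℕ → ℝ} (hδ : Tendsto δ atTop (𝓝 0))
    (hcau : ∀ n m, ∫ w, (f n w - f m w) ^ 2 ∂μ ≤ δ n + δ m) :
    ∃ φ : ℕ → ℕ, StrictMono φ ∧ ∃ g : S → ℝ, Measurable g ∧
      ∀ᵐ w ∂μ, Tendsto (fun n => f (φ n) w) atTop (𝓝 (g w)) := by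
  obtain ⟨φ, hφ, hφδ⟩ := extraction_forall_of_eventually
    (P := fun k N => ∀ n, N ≤ n → δ n < (1 / 4) ^ k / 2) fun k =>
      eventually_forall_ge_atTop.2 (hδ.eventually_lt_const (by positivity))
  refine ⟨φ, hφ, ?_⟩
  have h : ∀ᵐ w ∂μ, ∃ l : ℝ, Tendsto (fun n => f (φ n) w) atTop (𝓝 l) := by
    refine Lp.ae_tendsto_of_cauchy_eLpNorm (p := 2) (B := fun k => ENNReal.ofReal ((1 / 2) ^ k))
      (fun n => (hf (φ n)).1) (by norm_num) ?_ fun N n m hn hm => ?_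
    · rw [← ENNReal.ofReal_tsum_of_nonneg (fun _ => by positivity) summable_geometric_two]
      simp
    · rw [((hf _).sub (hf _)).eLpNorm_eq_integral_rpow_norm (by simp) (by simp)]
      refine (ENNReal.ofReal_lt_ofReal_iff (by positivity)).2 ?_
      have h1 := hcau (φ n) (φ m)
      have h2 := hφδ N (φ n) (hφ.monotone hn)
      have h3 := hφδ N (φ m) (hφ.monotone hm)
      simp only [Pi.sub_apply, ENNReal.toReal_ofNat, Real.rpow_ofNat, Real.norm_eq_abs, sq_abs]
      rw [← one_div, ← Real.sqrt_eq_rpow, Real.sqrt_lt' (by positivity), ← pow_mul, mul_comm N,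
        pow_mul]
      norm_num at *
      linarith
  exact measurable_limit_of_tendsto_metrizable_ae (fun n => (hf (φ n)).1.aemeasurable) h

variable {E : Type*} [IsFiniteMeasure μ]
  [NormedAddCommGroup E]

lemma uniformIntegrable_one_of_lintegral_sq_le {g : ℕ → S → E}
    (hg : ∀ n, AEStronglyMeasurable (g n) μ) {D : ℝ≥0} (hD : ∀ n, ∫⁻ w, ‖g n w‖ₑ ^ 2 ∂μ ≤ D) :
    UniformIntegrable g 1 μ := by
  refine uniformIntegrable_of le_rfl (by simp) hg fun ε hε => ?_
  lift ε to ℝ≥0 using hε.le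
  have hε' : 0 < ε := by exact_mod_cast hε
  have hC : 0 < D / ε + 1 := by positivity
  refine ⟨D / ε + 1, fun i => ?_⟩
  rw [eLpNorm_one_eq_lintegral_enorm]
  calc _ ≤ ∫⁻ w, ((D / ε + 1 : ℝ≥0) : ℝ≥0∞)⁻¹ * ‖g i w‖ₑ ^ 2 ∂μ := by
        refine lintegral_mono fun w => ?_
        by_cases hw : D / ε + 1 ≤ ‖g i w‖₊
        · rw [indicator_of_mem (by exact hw), enorm_eq_nnnorm, ← ENNReal.coe_inv hC.ne']
          norm_cast
          rw [ENNReal.coe_le_coe, ← div_eq_inv_mul, le_div_iff₀ hC, pow_two]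
          gcongr
        · rw [indicator_of_notMem (by exact hw)]; simp
    _ = ((D / ε + 1 : ℝ≥0) : ℝ≥0∞)⁻¹ * ∫⁻ w, ‖g i w‖ₑ ^ 2 ∂μ :=
        lintegral_const_mul' _ _ (by simp)
    _ ≤ ((D / ε + 1 : ℝ≥0) : ℝ≥0∞)⁻¹ * D := by gcongr; exact hD i
    _ ≤ _ := by
        rw [← ENNReal.coe_inv hC.ne', ENNReal.ofReal_coe_nnreal]
        norm_cast
        rw [← div_eq_inv_mul, div_le_iff₀ hC, mul_add, mul_div_cancel₀ _ hε'.ne']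
        simp

lemma tendsto_integral_of_lintegral_sq_le [NormedSpace ℝ E] {g : ℕ → S → E} {f : S → E}
    (hg : ∀ n, AEStronglyMeasurable (g n) μ) {D : ℝ≥0} (hD : ∀ n, ∫⁻ w, ‖g n w‖ₑ ^ 2 ∂μ ≤ D)
    (hf : ∀ᵐ w ∂μ, Tendsto (fun n => g n w) atTop (𝓝 (f w))) :
    Integrable f μ ∧ Tendsto (fun n => ∫ w, g n w ∂μ) atTop (𝓝 (∫ w, f w ∂μ)) := by
  have hUI := uniformIntegrable_one_of_lintegral_sq_le hg hD
  have hfi := hUI.integrable_of_ae_tendsto hf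
  exact ⟨hfi, tendsto_integral_of_L1' _ hfi.1
    (Eventually.of_forall fun n => memLp_one_iff_integrable.1 (hUI.memLp n))
    (tendsto_Lp_finite_of_tendsto_ae le_rfl (by simp) hg (memLp_one_iff_integrable.2 hfi)
      hUI.unifIntegrable hf)⟩

end Convergence

lemma integral_comp_floor_div {h : ℝ} (hh : 0 < h) (c : ℕ → ℝ) (n : ℕ) :
    IntervalIntegrable (fun s => c ⌊s / h⌋₊) volume 0 (n * h) ∧
    ∫ s in (0 : ℝ)..(n * h), c ⌊s / h⌋₊ = ∑ k ∈ Finset.range n, h * c k := by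
  induction n with
  | zero => simp
  | succ n ih =>
    have hle : (n : ℝ) * h ≤ (n + 1 : ℕ) * h := by push_cast; nlinarith
    have heq : EqOn (fun _ => c n) (fun s => c ⌊s / h⌋₊) (Ioo (n * h) ((n + 1 : ℕ) * h)) := by
      intro s hs
      have : ⌊s / h⌋₊ = n := by
        rw [Nat.floor_eq_iff (div_nonneg ((by positivity : 0 ≤ n * h).trans hs.1.le) hh.le),
          le_div_iff₀ hh, div_lt_iff₀ hh]
        exact ⟨hs.1.le, by have := hs.2; push_cast at this; exact this⟩
      simp [this]
    have hint : IntervalIntegrable (fun s => c ⌊s / h⌋₊) volume (n * h) ((n + 1 : ℕ) * h) := by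
      refine (intervalIntegrable_const (c := c n)).congr_ae ?_
      rw [uIoc_of_le hle, ← restrict_Ioo_eq_restrict_Ioc]
      exact (ae_restrict_mem measurableSet_Ioo).mono heq
    refine ⟨ih.1.trans hint, ?_⟩
    rw [← intervalIntegral.integral_add_adjacent_intervals ih.1 hint, ih.2,
      Finset.sum_range_succ, ← intervalIntegral.integral_congr_Ioo_of_le hle heq]
    simp only [intervalIntegral.integral_const, smul_eq_mul]
    push_cast; ring

lemma sum_range_mul_div (α f : ℕ → ℝ) (K : ℕ) {L : ℕ} (hL : 0 < L) :
    ∑ j ∈ Finset.range (K * L), α (j / L) * (f (j + 1) - f j)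
      = ∑ k ∈ Finset.range K, α k * (f ((k + 1) * L) - f (k * L)) := by
  induction K with
  | zero => simp
  | succ K ih =>
    rw [add_mul, one_mul, Finset.sum_range_add, ih, Finset.sum_range_succ]
    congr 1
    have : ∀ i ∈ Finset.range L, α ((K * L + i) / L) * (f (K * L + i + 1) - f (K * L + i))
        = α K * (f (K * L + (i + 1)) - f (K * L + i)) := fun i hi => by
      rw [mul_comm K L, Nat.mul_add_div hL, Nat.div_eq_of_lt (Finset.mem_range.1 hi), add_zero]
      rfl
    rw [Finset.sum_congr rfl this, ← Finset.mul_sum,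
      Finset.sum_range_sub fun i => f (K * L + i), add_mul, one_mul, add_zero]

lemma intervalIntegrable_of_abs_le {f : ℝ → ℝ} (hf : Measurable f) {D : ℝ} (hD : ∀ s, |f s| ≤ D)
    (t u : ℝ) : IntervalIntegrable f volume t u :=
  (intervalIntegrable_const (c := D)).mono_fun hf.aestronglyMeasurable
    (ae_of_all _ fun s => (hD s).trans (le_abs_self D))

lemma tendsto_div_nat_succ (T : ℝ) : Tendsto (fun n : ℕ => T / (n + 1 : ℕ)) atTop (𝓝 0) := by
  have := (tendsto_const_div_atTop_nhds_zero_nat T).comp (tendsto_add_atTop_nat 1)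
  exact this

lemma tendsto_floor_div_mul {h : ℕ → ℝ} (hh : ∀ n, 0 < h n) (hlim : Tendsto h atTop (𝓝 0))
    {s : ℝ} (hs : 0 ≤ s) : Tendsto (fun n => (⌊s / h n⌋₊ : ℝ) * h n) atTop (𝓝 s) := by
  refine tendsto_of_tendsto_of_tendsto_of_le_of_le (by simpa using hlim.const_sub s)
    tendsto_const_nhds (fun n => ?_) fun n => ?_
  · have := Nat.lt_floor_add_one (s / h n)
    rw [div_lt_iff₀ (hh n)] at this
    dsimp only
    linarith
  · exact (le_div_iff₀ (hh n)).1 (Nat.floor_le (div_nonneg hs (hh n).le))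

/-- Continuous real paths, with the σ-algebra generated by the evaluations. -/
abbrev PathSpace : Type := {w : ℝ → ℝ // Continuous w}

namespace PathSpace

lemma measurable_eval (t : ℝ) : Measurable fun w : PathSpace => w.1 t :=
  (measurable_pi_apply t).comp measurable_subtype_coe

lemma measurable_uncurry_eval : Measurable fun p : ℝ × PathSpace => p.2.1 p.1 :=
  measurable_uncurry_of_continuous_of_measurable (u := fun t (w : PathSpace) => w.1 t)
    (fun w => w.2) measurable_eval

/-- The path frozen after time `t`. -/
def freeze (t : ℝ) (w : PathSpace) : PathSpace :=
  ⟨fun u => w.1 (min u t), w.2.comp (continuous_id.min continuous_const)⟩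

lemma measurable_freeze (t : ℝ) : Measurable (freeze t) :=
  Measurable.subtype_mk (measurable_pi_lambda _ fun _ => measurable_eval _)

lemma freeze_freeze {s t : ℝ} (hst : s ≤ t) (w : PathSpace) : freeze s (freeze t w) = freeze s w := by
  ext u
  simp [freeze, hst]

/-- The canonical filtration. -/
abbrev past (t : ℝ) : MeasurableSpace PathSpace :=
  MeasurableSpace.comap (freeze t) inferInstance

lemma past_le (t : ℝ) : past t ≤ Subtype.instMeasurableSpace := (measurable_freeze t).comap_le

lemma past_mono : Monotone past := fun s t hst => by
  rintro _ ⟨A, hA, rfl⟩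
  refine ⟨freeze s ⁻¹' A, measurable_freeze s hA, ?_⟩
  ext w
  simp [freeze_freeze hst]

lemma measurable_past_of_freeze {β : Type*} [MeasurableSpace β] {t : ℝ} {f : PathSpace → β}
    (hf : Measurable f) (h : ∀ w, f (freeze t w) = f w) : Measurable[past t] f := by
  have : f = f ∘ freeze t := by ext w; exact (h w).symm
  rw [this]
  exact hf.comp (comap_measurable _)

/-- The running maximum over `[0, s]`, written as a countable supremum. -/
noncomputable def runningMax (w : PathSpace) (s : ℝ) : ℝ :=
  ⨆ r : ℚ, w.1 (max 0 (min (r : ℝ) s))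

lemma runningMax_eq_sSup (w : PathSpace) {s : ℝ} (hs : 0 ≤ s) :
    runningMax w s = sSup (w.1 '' Icc 0 s) := by
  have hbdd : BddAbove (w.1 '' Icc 0 s) := (isCompact_Icc.image w.2).bddAbove
  have hmem : ∀ r : ℝ, max 0 (min r s) ∈ Icc 0 s := fun r =>
    ⟨le_max_left _ _, max_le hs (min_le_right _ _)⟩
  have hbdd' : BddAbove (range fun r : ℚ => w.1 (max 0 (min (r : ℝ) s))) :=
    hbdd.mono (range_subset_iff.2 fun r => mem_image_of_mem _ (hmem r))
  refine le_antisymm (ciSup_le fun r => le_csSup hbdd (mem_image_of_mem _ (hmem r))) ?_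
  refine csSup_le ((nonempty_Icc.2 hs).image _) ?_
  rintro _ ⟨u, hu, rfl⟩
  have key : ∀ v : ℝ, w.1 (max 0 (min v s)) ≤ runningMax w s := by
    have hc : Continuous fun v : ℝ => w.1 (max 0 (min v s)) := w.2.comp (by fun_prop)
    exact isClosed_property Rat.denseRange_cast (isClosed_le hc continuous_const)
      fun r => le_ciSup hbdd' r
  have := key u
  rwa [min_eq_left hu.2, max_eq_right hu.1] at this

lemma measurable_runningMax : Measurable fun p : ℝ × PathSpace => runningMax p.2 p.1 := by
  refine Measurable.iSup fun r => ?_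
  exact measurable_uncurry_eval.comp
    ((measurable_const.max (measurable_const.min measurable_fst)).prodMk measurable_snd)

variable {b : ℝ → ℝ → ℝ} {C T x : ℝ} {μ μ' : Measure PathSpace}

/-- The drift at time `s` along the path `w`. -/
noncomputable def drift (b : ℝ → ℝ → ℝ) (s : ℝ) (w : PathSpace) : ℝ := b (w.1 s) (runningMax w s)

lemma measurable_drift (hb : Measurable (Function.uncurry b)) :
    Measurable fun p : ℝ × PathSpace => drift b p.1 p.2 :=
  hb.comp (measurable_uncurry_eval.prodMk measurable_runningMax)

lemma measurable_drift_left (hb : Measurable (Function.uncurry b)) (w : PathSpace) :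
    Measurable fun s => drift b s w :=
  (measurable_drift hb).comp (measurable_id.prodMk measurable_const)

lemma drift_freeze {s t : ℝ} (ht : 0 ≤ t) (hst : s ≤ t) (w : PathSpace) :
    drift b s (freeze t w) = drift b s w := by
  have : ∀ r : ℝ, max 0 (min r s) ≤ t := fun r => max_le ht ((min_le_right _ _).trans hst)
  simp [drift, runningMax, freeze, hst, this]

/-- The path minus its accumulated drift. -/
noncomputable def noise (b : ℝ → ℝ → ℝ) (t : ℝ) (w : PathSpace) : ℝ :=
  w.1 t - ∫ s in (0 : ℝ)..t, drift b s w

lemma measurable_intervalIntegral {f : ℝ → PathSpace → ℝ}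
    (hf : Measurable fun p : ℝ × PathSpace => f p.1 p.2) (t u : ℝ) :
    Measurable fun w => ∫ s in t..u, f s w := by
  have h : StronglyMeasurable fun p : PathSpace × ℝ => f p.2 p.1 :=
    (hf.comp measurable_swap).stronglyMeasurable
  simp only [intervalIntegral]
  exact (h.integral_prod_right' (ν := volume.restrict (Ioc t u))).measurable.sub
    (h.integral_prod_right' (ν := volume.restrict (Ioc u t))).measurable

lemma measurable_noise (hb : Measurable (Function.uncurry b)) (t : ℝ) :
    Measurable (noise b t) :=
  (measurable_eval t).sub (measurable_intervalIntegral (measurable_drift hb) 0 t)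

lemma noise_freeze {s t : ℝ} (hs : 0 ≤ s) (hst : s ≤ t) (w : PathSpace) :
    noise b s (freeze t w) = noise b s w := by
  have h : ∫ u in (0 : ℝ)..s, drift b u (freeze t w) = ∫ u in (0 : ℝ)..s, drift b u w := by
    refine intervalIntegral.integral_congr fun u hu => ?_
    rw [uIcc_of_le hs] at hu
    exact drift_freeze (hs.trans hst) (hu.2.trans hst) w
  simp only [noise, h]
  simp [freeze, hst]

/-- The average of the drift over the `k`-th mesh interval `[(k - 1) h, k h]`. -/
noncomputable def avgDrift (b : ℝ → ℝ → ℝ) (h : ℝ) (k : ℕ) (w : PathSpace) : ℝ :=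
  ⨍ s in Metric.closedBall (((k : ℝ) - 1 / 2) * h) (h / 2), drift b s w

lemma measurable_avgDrift (hb : Measurable (Function.uncurry b)) (h : ℝ) (k : ℕ) :
    Measurable (avgDrift b h k) := by
  have hm : StronglyMeasurable fun p : PathSpace × ℝ => drift b p.2 p.1 :=
    ((measurable_drift hb).comp measurable_swap).stronglyMeasurable
  unfold avgDrift
  simp_rw [setAverage_eq, smul_eq_mul]
  exact (hm.integral_prod_right'
    (ν := volume.restrict (Metric.closedBall (((k : ℝ) - 1 / 2) * h) (h / 2)))).measurable.const_mul
      _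

lemma avgDrift_freeze {h : ℝ} (hh : 0 ≤ h) {k : ℕ} {t : ℝ} (ht : k * h ≤ t) (w : PathSpace) :
    avgDrift b h k (freeze t w) = avgDrift b h k w := by
  unfold avgDrift
  rw [setAverage_eq, setAverage_eq]
  congr 1
  refine setIntegral_congr_fun Metric.isClosed_closedBall.measurableSet fun s hs => ?_
  rw [Real.closedBall_eq_Icc] at hs
  exact drift_freeze ((by positivity : 0 ≤ k * h).trans ht) (by linarith [hs.2]) w

lemma abs_avgDrift_le {C : ℝ} (hC : ∀ p q, |b p q| ≤ C) {h : ℝ} (hh : 0 < h) (k : ℕ)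
    (w : PathSpace) : |avgDrift b h k w| ≤ C := by
  have hpos : 0 < volume.real (Metric.closedBall (((k : ℝ) - 1 / 2) * h) (h / 2)) := by
    rw [measureReal_def, Real.volume_closedBall, ENNReal.toReal_ofReal (by positivity)]
    positivity
  unfold avgDrift
  rw [setAverage_eq, smul_eq_mul, abs_mul, abs_of_pos (inv_pos.2 hpos), inv_mul_le_iff₀' hpos]
  exact norm_setIntegral_le_of_norm_le_const (f := fun s => drift b s w)
    (by rw [Real.volume_closedBall]; exact ENNReal.ofReal_lt_top) fun s _ => hC _ _

/-- The step process built from the averages of the drift over the preceding mesh interval. -/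
noncomputable def stepDrift (b : ℝ → ℝ → ℝ) (h s : ℝ) (w : PathSpace) : ℝ :=
  avgDrift b h ⌊s / h⌋₊ w

lemma measurable_stepDrift (hb : Measurable (Function.uncurry b)) (h : ℝ) :
    Measurable fun p : ℝ × PathSpace => stepDrift b h p.1 p.2 := by
  have h1 : Measurable fun q : ℕ × PathSpace => avgDrift b h q.1 q.2 :=
    measurable_from_prod_countable_right fun k => measurable_avgDrift hb h k
  have h2 : Measurable fun p : ℝ × PathSpace => ⌊p.1 / h⌋₊ :=
    Nat.measurable_floor.comp (measurable_fst.div_const h)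
  have h3 := h1.comp (h2.prodMk measurable_snd)
  simpa only [stepDrift, Function.comp_def] using h3

lemma ae_tendsto_stepDrift (hb : Measurable (Function.uncurry b)) {C : ℝ}
    (hC : ∀ p q, |b p q| ≤ C) (w : PathSpace) {h : ℕ → ℝ} (hh : ∀ n, 0 < h n)
    (hlim : Tendsto h atTop (𝓝 0)) :
    ∀ᵐ s : ℝ, 0 ≤ s → Tendsto (fun n => stepDrift b (h n) s w) atTop (𝓝 (drift b s w)) := by
  have hloc : LocallyIntegrable (fun s => drift b s w) volume := by
    refine (locallyIntegrable_const C).mono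
      (measurable_drift_left hb w).aestronglyMeasurable (ae_of_all _ fun s => ?_)
    exact (hC _ _).trans (le_abs_self C)
  filter_upwards [IsUnifLocDoublingMeasure.ae_tendsto_average volume hloc 3] with s hs hs0
  refine hs (fun n => ((⌊s / h n⌋₊ : ℝ) - 1 / 2) * h n) (fun n => h n / 2) ?_ ?_
  · refine tendsto_nhdsWithin_iff.2 ⟨by simpa using hlim.div_const 2, ?_⟩
    exact Eventually.of_forall fun n => half_pos (hh n)
  · refine Eventually.of_forall fun n => ?_
    have h1 := Nat.floor_le (div_nonneg hs0 (hh n).le)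
    have h2 := Nat.lt_floor_add_one (s / h n)
    rw [le_div_iff₀ (hh n)] at h1
    rw [div_lt_iff₀ (hh n)] at h2
    rw [Real.closedBall_eq_Icc]
    constructor <;> linarith [hh n]

/-- `μ` is the law of a process on `[0, T]`, frozen outside this interval, which starts at `x` and
whose `noise` is a Brownian motion in its canonical filtration. -/
structure IsDriftedLaw (b : ℝ → ℝ → ℝ) (x T : ℝ) (μ : Measure PathSpace) : Prop where
  clamp : ∀ t, ∀ᵐ w ∂μ, w.1 t = w.1 (max 0 (min t T))
  zero : ∀ᵐ w ∂μ, w.1 0 = x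
  indep : ∀ s t, 0 ≤ s → s ≤ t → t ≤ T → Indep
    (MeasurableSpace.comap (fun w => noise b t w - noise b s w) Real.measurableSpace) (past s) μ
  law : ∀ s t, 0 ≤ s → s ≤ t → t ≤ T →
    μ.map (fun w => noise b t w - noise b s w) = gaussianReal 0 (t - s).toNNReal

/-- The increment of the noise over the `k`-th mesh interval `[k h, (k + 1) h]`. -/
noncomputable def increment (b : ℝ → ℝ → ℝ) (h : ℝ) (k : ℕ) (w : PathSpace) : ℝ :=
  noise b ((k + 1 : ℕ) * h) w - noise b (k * h) w

lemma IsDriftedLaw.gaussianIncrements (hμ : IsDriftedLaw b x T μ)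
    (hb : Measurable (Function.uncurry b)) {h : ℝ} (hh : 0 ≤ h) {K : ℕ} (hK : K * h ≤ T) :
    GaussianIncrements μ (fun k => past (k * h)) K h.toNNReal (increment b h) := by
  have hle : ∀ k : ℕ, (k : ℝ) * h ≤ (k + 1 : ℕ) * h := fun k => by push_cast; nlinarith
  have hT : ∀ k < K, ((k + 1 : ℕ) : ℝ) * h ≤ T := fun k hk => by
    refine le_trans ?_ hK
    gcongr
    exact hk
  refine ⟨monotone_nat_of_le_succ fun k => past_mono (hle k), fun k => past_le _, fun k _ => ?_,
    fun k hk => hμ.indep _ _ (by positivity) (hle k) (hT k hk), fun k hk => ?_⟩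
  · refine measurable_past_of_freeze ((measurable_noise hb _).sub (measurable_noise hb _)) fun w => ?_
    rw [increment, noise_freeze (by positivity) le_rfl, noise_freeze (by positivity) (hle k)]
    rfl
  · have := hμ.law _ _ (by positivity) (hle k) (hT k hk)
    unfold increment
    rw [this]
    congr 2
    push_cast; ring

lemma measurable_past_avgDrift (hb : Measurable (Function.uncurry b)) {h : ℝ} (hh : 0 ≤ h) {k : ℕ}
    {t : ℝ} (ht : k * h ≤ t) : Measurable[past t] (avgDrift b h k) :=
  measurable_past_of_freeze (measurable_avgDrift hb h k) fun w => avgDrift_freeze hh ht w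

/-- The integral of the step process against the noise over `n` mesh intervals. -/
noncomputable def stepIntegral (b : ℝ → ℝ → ℝ) (h : ℝ) (n : ℕ) (w : PathSpace) : ℝ :=
  ∑ k ∈ Finset.range n, avgDrift b h k w * increment b h k w

lemma measurable_increment (hb : Measurable (Function.uncurry b)) (h : ℝ) (k : ℕ) :
    Measurable (increment b h k) := (measurable_noise hb _).sub (measurable_noise hb _)

lemma measurable_stepIntegral (hb : Measurable (Function.uncurry b)) (h : ℝ) (n : ℕ) :
    Measurable (stepIntegral b h n) :=
  Finset.measurable_sum _ fun k _ => (measurable_avgDrift hb h k).mul (measurable_increment hb h k)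

lemma stepIntegral_refine (h : ℝ) (n : ℕ) {L : ℕ} (hL : 0 < L) (w : PathSpace) :
    stepIntegral b h n w
      = ∑ j ∈ Finset.range (n * L), avgDrift b h (j / L) w * increment b (h / L) j w := by
  have hL' : (L : ℝ) ≠ 0 := by positivity
  rw [stepIntegral]
  have := sum_range_mul_div (fun k => avgDrift b h k w) (fun j => noise b (j * (h / L)) w) n hL
  simp only [increment]
  rw [this]
  refine Finset.sum_congr rfl fun k _ => ?_
  have e : ∀ i : ℕ, ((i * L : ℕ) : ℝ) * (h / L) = i * h := fun i => by push_cast; field_simp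
  rw [e, e]

lemma stepDrift_refine {h s : ℝ} {L : ℕ} (hL : 0 < L) (w : PathSpace) :
    stepDrift b h s w = avgDrift b h (⌊s / (h / L)⌋₊ / L) w := by
  have hL' : (L : ℝ) ≠ 0 := by positivity
  rw [stepDrift, ← Nat.floor_div_natCast]
  congr 2
  field_simp

lemma IsDriftedLaw.integral_sq_stepIntegral_sub [IsProbabilityMeasure μ]
    (hμ : IsDriftedLaw b x T μ) (hb : Measurable (Function.uncurry b))
    (hC : ∀ p q, |b p q| ≤ C) (hT : 0 < T) {K L : ℕ} (hK : 0 < K) (hL : 0 < L) :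
    ∫ w, (stepIntegral b (T / K) K w - stepIntegral b (T / L) L w) ^ 2 ∂μ
      = ∫ w, (∫ s in (0 : ℝ)..T, (stepDrift b (T / K) s w - stepDrift b (T / L) s w) ^ 2) ∂μ := by
  have hK' : (0 : ℝ) < K := by positivity
  have hL' : (0 : ℝ) < L := by positivity
  have hv : 0 < T / K / L := by positivity
  have hvT : ((K * L : ℕ) : ℝ) * (T / K / L) = T := by push_cast; field_simp
  have hcomm : T / L / K = T / K / L := by field_simp
  have hG := hμ.gaussianIncrements hb hv.le hvT.le
  have ha : ∀ j < K * L, Measurable[past (j * (T / K / L))]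
      fun w => avgDrift b (T / K) (j / L) w - avgDrift b (T / L) (j / K) w := fun j _ => by
    have e1 : ((j / L : ℕ) : ℝ) * (T / K) ≤ j * (T / K / L) := by
      have : ((j / L : ℕ) : ℝ) ≤ j / L := Nat.cast_div_le
      calc _ ≤ (j / L : ℝ) * (T / K) := by gcongr
        _ = _ := by ring
    have e2 : ((j / K : ℕ) : ℝ) * (T / L) ≤ j * (T / K / L) := by
      have : ((j / K : ℕ) : ℝ) ≤ j / K := Nat.cast_div_le
      calc _ ≤ (j / K : ℝ) * (T / L) := by gcongr
        _ = _ := by ring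
    exact (measurable_past_avgDrift hb (by positivity) e1).sub
      (measurable_past_avgDrift hb (by positivity) e2)
  have haC : ∀ j w, |avgDrift b (T / K) (j / L) w - avgDrift b (T / L) (j / K) w| ≤ C + C :=
    fun j w => (abs_sub _ _).trans (add_le_add (abs_avgDrift_le hC (by positivity) _ w)
      (abs_avgDrift_le hC (by positivity) _ w))
  have := (hG.integral_sum_mul_sq ha haC le_rfl).2
  have e : ∀ w, stepIntegral b (T / K) K w - stepIntegral b (T / L) L w
      = ∑ j ∈ Finset.range (K * L), (avgDrift b (T / K) (j / L) w - avgDrift b (T / L) (j / K) w)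
        * increment b (T / K / L) j w := fun w => by
    rw [stepIntegral_refine _ K hL, stepIntegral_refine _ L hK, hcomm, mul_comm L K,
      ← Finset.sum_sub_distrib]
    simp_rw [sub_mul]
  simp_rw [e]
  rw [this]
  refine integral_congr_ae (ae_of_all _ fun w => ?_)
  dsimp only
  have := (integral_comp_floor_div hv (fun j => (avgDrift b (T / K) (j / L) w
    - avgDrift b (T / L) (j / K) w) ^ 2) (K * L)).2
  rw [hvT] at this
  rw [Real.coe_toNNReal _ hv.le, ← this]
  refine intervalIntegral.integral_congr fun s _ => ?_
  rw [stepDrift_refine hL, stepDrift_refine hK, hcomm]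

lemma IsDriftedLaw.memLp_stepIntegral [IsProbabilityMeasure μ]
    (hμ : IsDriftedLaw b x T μ) (hb : Measurable (Function.uncurry b))
    (hC : ∀ p q, |b p q| ≤ C) {h : ℝ} (hh : 0 < h) {K : ℕ} (hK : K * h ≤ T) :
    MemLp (stepIntegral b h K) 2 μ :=
  ((hμ.gaussianIncrements hb hh.le hK).integral_sum_mul_sq
    (fun _ _ => measurable_past_avgDrift hb hh.le le_rfl)
    (fun k w => abs_avgDrift_le hC hh k w) le_rfl).1

lemma abs_stepDrift_le (hC : ∀ p q, |b p q| ≤ C) {h : ℝ} (hh : 0 < h) (s : ℝ) (w : PathSpace) :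
    |stepDrift b h s w| ≤ C := abs_avgDrift_le hC hh _ w

lemma measurable_stepDrift_left (h : ℝ) (w : PathSpace) :
    Measurable fun s => stepDrift b h s w :=
  (Measurable.of_discrete (f := fun k : ℕ => avgDrift b h k w)).comp
    (Nat.measurable_floor.comp (measurable_id.div_const h))

lemma tendsto_intervalIntegral_comp_stepDrift (hb : Measurable (Function.uncurry b))
    (hC : ∀ p q, |b p q| ≤ C) (w : PathSpace) {h : ℕ → ℝ} (hh : ∀ n, 0 < h n)
    (hlim : Tendsto h atTop (𝓝 0)) {t : ℝ} (ht : 0 ≤ t) {Φ : ℝ → ℝ → ℝ}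
    (hΦ : Continuous (Function.uncurry Φ)) :
    Tendsto (fun n => ∫ s in (0 : ℝ)..t, Φ (stepDrift b (h n) s w) (drift b s w)) atTop
      (𝓝 (∫ s in (0 : ℝ)..t, Φ (drift b s w) (drift b s w))) := by
  obtain ⟨D, hD⟩ := (isCompact_Icc.prod isCompact_Icc :
    IsCompact (Icc (-C) C ×ˢ Icc (-C) C)).exists_bound_of_continuousOn hΦ.continuousOn
  refine intervalIntegral.tendsto_integral_filter_of_dominated_convergence (fun _ => D)
    (Eventually.of_forall fun n => ?_) (Eventually.of_forall fun n => ae_of_all _ fun s _ => ?_)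
    intervalIntegrable_const ?_
  · exact (hΦ.measurable.comp ((measurable_stepDrift_left _ w).prodMk
      (measurable_drift_left hb w))).aestronglyMeasurable
  · exact hD (_, _) ⟨abs_le.1 (abs_stepDrift_le hC (hh n) s w), abs_le.1 (hC _ _)⟩
  · filter_upwards [ae_tendsto_stepDrift hb hC w hh hlim] with s hs hst
    rw [uIoc_of_le ht] at hst
    exact (hΦ.tendsto _).comp ((hs hst.1.le).prodMk_nhds tendsto_const_nhds)

lemma measurable_integral_sq_stepDrift_sub (hb : Measurable (Function.uncurry b)) (h t : ℝ) :
    Measurable fun w => ∫ s in (0 : ℝ)..t, (stepDrift b h s w - drift b s w) ^ 2 :=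
  measurable_intervalIntegral (f := fun s w => (stepDrift b h s w - drift b s w) ^ 2)
    (((measurable_stepDrift hb h).sub (measurable_drift hb)).pow_const 2) 0 t

lemma tendsto_integral_sq_stepDrift_sub [IsProbabilityMeasure μ]
    (hb : Measurable (Function.uncurry b)) (hC : ∀ p q, |b p q| ≤ C) {h : ℕ → ℝ}
    (hh : ∀ n, 0 < h n) (hlim : Tendsto h atTop (𝓝 0)) {t : ℝ} (ht : 0 ≤ t) :
    Tendsto (fun n => ∫ w, (∫ s in (0 : ℝ)..t, (stepDrift b (h n) s w - drift b s w) ^ 2) ∂μ)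
      atTop (𝓝 0) := by
  have hle : ∀ n s w, (stepDrift b (h n) s w - drift b s w) ^ 2 ≤ (C + C) ^ 2 := fun n s w => by
    refine sq_le_sq' ?_ ?_ <;>
      linarith [abs_le.1 (abs_stepDrift_le hC (hh n) s w), abs_le.1 (hC (w.1 s) (runningMax w s)),
        show drift b s w = b (w.1 s) (runningMax w s) from rfl]
  suffices h0 : Tendsto (fun n => ∫ w, (∫ s in (0 : ℝ)..t,
      (stepDrift b (h n) s w - drift b s w) ^ 2) ∂μ) atTop (𝓝 (∫ _, 0 ∂μ)) by simpa using h0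
  refine tendsto_integral_of_dominated_convergence (fun _ => (C + C) ^ 2 * |t - 0|)
    (fun n => ?_) (integrable_const _) (fun n => ae_of_all _ fun w => ?_) (ae_of_all _ fun w => ?_)
  · exact (measurable_integral_sq_stepDrift_sub hb _ t).aestronglyMeasurable
  · refine intervalIntegral.norm_integral_le_of_norm_le_const fun s _ => ?_
    rw [Real.norm_of_nonneg (sq_nonneg _)]
    exact hle n s w
  · have := tendsto_intervalIntegral_comp_stepDrift hb hC w hh hlim ht
      (Φ := fun p q => (p - q) ^ 2) (by unfold Function.uncurry; fun_prop)
    simpa using this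

lemma intervalIntegrable_sq_stepDrift_sub (hb : Measurable (Function.uncurry b))
    (hC : ∀ p q, |b p q| ≤ C) {h : ℝ} (hh : 0 < h) (w : PathSpace) (t u : ℝ) :
    IntervalIntegrable (fun s => (stepDrift b h s w - drift b s w) ^ 2) volume t u := by
  refine intervalIntegrable_of_abs_le (D := (C + C) ^ 2)
    (((measurable_stepDrift_left h w).sub (measurable_drift_left hb w)).pow_const 2)
    (fun s => ?_) t u
  rw [abs_pow]
  gcongr
  exact (abs_sub _ _).trans (add_le_add (abs_stepDrift_le hC hh s w) (hC _ _))

lemma integrable_integral_sq_stepDrift_sub [IsProbabilityMeasure μ]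
    (hb : Measurable (Function.uncurry b)) (hC : ∀ p q, |b p q| ≤ C) {h : ℝ} (hh : 0 < h) (t : ℝ) :
    Integrable (fun w => ∫ s in (0 : ℝ)..t, (stepDrift b h s w - drift b s w) ^ 2) μ := by
  refine .of_bound (C := (C + C) ^ 2 * |t - 0|)
    (measurable_integral_sq_stepDrift_sub hb h t).aestronglyMeasurable
    (ae_of_all _ fun w => intervalIntegral.norm_integral_le_of_norm_le_const fun s _ => ?_)
  rw [norm_pow]
  gcongr
  exact (abs_sub _ _).trans (add_le_add (abs_stepDrift_le hC hh s w) (hC _ _))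

lemma IsDriftedLaw.integral_sq_stepIntegral_sub_le [IsProbabilityMeasure μ]
    (hμ : IsDriftedLaw b x T μ) (hb : Measurable (Function.uncurry b))
    (hC : ∀ p q, |b p q| ≤ C) (hT : 0 < T) {K L : ℕ} (hK : 0 < K) (hL : 0 < L) :
    ∫ w, (stepIntegral b (T / K) K w - stepIntegral b (T / L) L w) ^ 2 ∂μ
      ≤ 2 * ∫ w, (∫ s in (0 : ℝ)..T, (stepDrift b (T / K) s w - drift b s w) ^ 2) ∂μ
        + 2 * ∫ w, (∫ s in (0 : ℝ)..T, (stepDrift b (T / L) s w - drift b s w) ^ 2) ∂μ := by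
  have hK' : 0 < T / K := by positivity
  have hL' : 0 < T / L := by positivity
  have hiK := integrable_integral_sq_stepDrift_sub (μ := μ) hb hC hK' T
  have hiL := integrable_integral_sq_stepDrift_sub (μ := μ) hb hC hL' T
  rw [hμ.integral_sq_stepIntegral_sub hb hC hT hK hL, ← integral_const_mul, ← integral_const_mul,
    ← integral_add (hiK.const_mul 2) (hiL.const_mul 2)]
  refine integral_mono_of_nonneg (ae_of_all _ fun w => ?_) ((hiK.const_mul 2).add (hiL.const_mul 2))
    (ae_of_all _ fun w => ?_)
  · exact intervalIntegral.integral_nonneg hT.le fun s _ => sq_nonneg _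
  · have h1 := intervalIntegrable_sq_stepDrift_sub hb hC hK' w 0 T
    have h2 := intervalIntegrable_sq_stepDrift_sub hb hC hL' w 0 T
    dsimp only
    rw [← intervalIntegral.integral_const_mul, ← intervalIntegral.integral_const_mul,
      ← intervalIntegral.integral_add (h1.const_mul 2) (h2.const_mul 2)]
    refine intervalIntegral.integral_mono_on hT.le ?_ ((h1.const_mul 2).add (h2.const_mul 2))
      fun s _ => ?_
    · refine intervalIntegrable_of_abs_le (D := (C + C) ^ 2)
        (((measurable_stepDrift_left _ w).sub (measurable_stepDrift_left _ w)).pow_const 2)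
        (fun s => ?_) _ _
      rw [abs_pow]
      gcongr
      exact (abs_sub _ _).trans
        (add_le_add (abs_stepDrift_le hC hK' s w) (abs_stepDrift_le hC hL' s w))
    · nlinarith [sq_nonneg (stepDrift b (T / K) s w + stepDrift b (T / L) s w - 2 * drift b s w)]

/-- Along a common subsequence the step integrals converge almost surely for both laws. -/
lemma exists_subseq_tendsto_stepIntegral [IsProbabilityMeasure μ]
    [IsProbabilityMeasure μ'] (hμ : IsDriftedLaw b x T μ) (hμ' : IsDriftedLaw b x T μ')
    (hb : Measurable (Function.uncurry b)) (hC : ∀ p q, |b p q| ≤ C) (hT : 0 < T) :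
    ∃ φ : ℕ → ℕ, StrictMono φ ∧ ∃ J : PathSpace → ℝ, Measurable J ∧ ∀ᵐ w ∂(μ + μ'),
      Tendsto (fun n => stepIntegral b (T / (φ n + 1 : ℕ)) (φ n + 1) w) atTop (𝓝 (J w)) := by
  have hpos : ∀ n : ℕ, 0 < T / (n + 1 : ℕ) := fun n => by positivity
  have hKT : ∀ n : ℕ, ((n + 1 : ℕ) : ℝ) * (T / (n + 1 : ℕ)) ≤ T := fun n => by
    rw [mul_div_cancel₀ _ (by positivity)]
  have hm : ∀ n : ℕ, MemLp (stepIntegral b (T / (n + 1 : ℕ)) (n + 1)) 2 μ :=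
    fun n => hμ.memLp_stepIntegral hb hC (hpos n) (hKT n)
  have hm' : ∀ n : ℕ, MemLp (stepIntegral b (T / (n + 1 : ℕ)) (n + 1)) 2 μ' :=
    fun n => hμ'.memLp_stepIntegral hb hC (hpos n) (hKT n)
  have hδ := tendsto_integral_sq_stepDrift_sub (μ := μ) hb hC hpos (tendsto_div_nat_succ T) hT.le
  have hδ' := tendsto_integral_sq_stepDrift_sub (μ := μ') hb hC hpos (tendsto_div_nat_succ T) hT.le
  have hδδ' := (hδ.const_mul 2).add (hδ'.const_mul 2)
  rw [mul_zero, add_zero] at hδδ'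
  refine exists_subseq_ae_tendsto_of_integral_sq_le
    (f := fun n => stepIntegral b (T / (n + 1 : ℕ)) (n + 1)) (fun n => ?_)
    hδδ' fun n k => ?_
  · rw [memLp_two_iff_integrable_sq (measurable_stepIntegral hb _ _).aestronglyMeasurable]
    exact (hm n).integrable_sq.add_measure (hm' n).integrable_sq
  have h0 := integral_add_measure ((hm n).sub (hm k)).integrable_sq
    ((hm' n).sub (hm' k)).integrable_sq
  simp only [Pi.sub_apply] at h0
  rw [h0]
  exact (add_le_add (hμ.integral_sq_stepIntegral_sub_le hb hC hT n.succ_pos k.succ_pos)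
    (hμ'.integral_sq_stepIntegral_sub_le hb hC hT n.succ_pos k.succ_pos)).trans
      (add_add_add_comm _ _ _ _).le

lemma continuous_noise (hb : Measurable (Function.uncurry b)) (hC : ∀ p q, |b p q| ≤ C)
    (w : PathSpace) : Continuous fun t => noise b t w :=
  w.2.sub (intervalIntegral.continuous_primitive
    (intervalIntegrable_of_abs_le (measurable_drift_left hb w) fun _ => hC _ _) 0)

lemma tendsto_sum_avgDrift (hb : Measurable (Function.uncurry b))
    (hC : ∀ p q, |b p q| ≤ C) (w : PathSpace) {h : ℕ → ℝ} (hh : ∀ n, 0 < h n)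
    (hlim : Tendsto h atTop (𝓝 0)) {s : ℝ} (hs : 0 ≤ s) :
    Tendsto (fun n => ∑ i ∈ Finset.range ⌊s / h n⌋₊, h n * avgDrift b (h n) i w) atTop
      (𝓝 (∫ u in (0 : ℝ)..s, drift b u w)) := by
  have h1 := tendsto_intervalIntegral_comp_stepDrift hb hC w hh hlim hs
    (Φ := fun p _ => p) (by unfold Function.uncurry; fun_prop)
  have hfl := tendsto_floor_div_mul hh hlim hs
  have h2 : Tendsto (fun n => ∫ u in s..(⌊s / h n⌋₊ * h n), stepDrift b (h n) u w) atTop (𝓝 0) := by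
    refine squeeze_zero_norm (fun n => intervalIntegral.norm_integral_le_of_norm_le_const
      fun u _ => abs_stepDrift_le hC (hh n) u w) ?_
    simpa using ((hfl.sub_const s).abs).const_mul C
  have h3 := h1.add h2
  rw [add_zero] at h3
  refine h3.congr fun n => ?_
  have hi := intervalIntegrable_of_abs_le (measurable_stepDrift_left (h n) w)
    fun u => abs_stepDrift_le hC (hh n) u w
  rw [intervalIntegral.integral_add_adjacent_intervals (hi _ _) (hi _ _)]
  exact (integral_comp_floor_div (hh n) (fun k => avgDrift b (h n) k w) _).2

lemma sum_increment (h : ℝ) (k : ℕ) (w : PathSpace) :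
    ∑ i ∈ Finset.range k, increment b h i w = noise b (k * h) w - noise b 0 w := by
  have := Finset.sum_range_sub (fun i : ℕ => noise b (i * h) w) k
  simpa [increment] using this

/-- The inverse of the Girsanov density on a mesh, times the character of the path with the
discretised drift added back. -/
noncomputable def meshGirsanov (b : ℝ → ℝ → ℝ) (h : ℝ) (K : ℕ) {ι : Type*} (I : Finset ι)
    (s θ : ι → ℝ) (w : PathSpace) : ℂ :=
  (Real.exp (-stepIntegral b h K w
      - (∑ i ∈ Finset.range K, h * avgDrift b h i w ^ 2) / 2) : ℝ) *
    Complex.exp ((∑ j ∈ I, θ j * (noise b (⌊s j / h⌋₊ * h) w - noise b 0 w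
      + ∑ i ∈ Finset.range ⌊s j / h⌋₊, h * avgDrift b h i w) : ℝ) * Complex.I)

lemma measurable_meshGirsanov (hb : Measurable (Function.uncurry b)) (h : ℝ) (K : ℕ) {ι : Type*}
    (I : Finset ι) (s θ : ι → ℝ) : Measurable (meshGirsanov b h K I s θ) := by
  have h1 := measurable_stepIntegral hb h K
  have h2 := measurable_avgDrift hb h
  have h3 := measurable_noise hb
  unfold meshGirsanov
  fun_prop

lemma enorm_meshGirsanov (h : ℝ) (K : ℕ) {ι : Type*} (I : Finset ι) (s θ : ι → ℝ) (w : PathSpace) :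
    ‖meshGirsanov b h K I s θ w‖ₑ = ENNReal.ofReal (Real.exp (-stepIntegral b h K w
      - (∑ i ∈ Finset.range K, h * avgDrift b h i w ^ 2) / 2)) := by
  rw [meshGirsanov, enorm_mul, ← ofReal_norm (Complex.exp _), Complex.norm_exp_ofReal_mul_I,
    ← ofReal_norm, Complex.norm_real, Real.norm_of_nonneg (Real.exp_pos _).le]
  simp

lemma IsDriftedLaw.integral_meshGirsanov [IsProbabilityMeasure μ] (hμ : IsDriftedLaw b x T μ)
    (hb : Measurable (Function.uncurry b)) (hC : ∀ p q, |b p q| ≤ C) {h : ℝ} (hh : 0 < h) {K : ℕ}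
    (hK : K * h = T) {ι : Type*} (I : Finset ι) (s θ : ι → ℝ) (hs : ∀ j ∈ I, s j ≤ T) :
    ∫ w, meshGirsanov b h K I s θ w ∂μ = Complex.exp (-∑ i ∈ Finset.range K,
      (h * ((∑ j ∈ I, if i < ⌊s j / h⌋₊ then θ j else 0 : ℝ) : ℂ) ^ 2 / 2 : ℂ)) := by
  have hG := hμ.gaussianIncrements hb hh.le hK.le
  have hgir := (hG.integral_girsanov (fun _ _ => measurable_past_avgDrift hb hh.le le_rfl)
    (fun k w => abs_avgDrift_le hC hh k w)
    (fun i => ∑ j ∈ I, if i < ⌊s j / h⌋₊ then θ j else 0) le_rfl).2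
  have hv : ((h.toNNReal : ℝ) : ℂ) = (h : ℂ) := by rw [Real.coe_toNNReal _ hh.le]
  simp only [hv] at hgir
  rw [← hgir]
  refine integral_congr_ae (ae_of_all _ fun w => ?_)
  have hk : ∀ j ∈ I, ⌊s j / h⌋₊ ≤ K := fun j hj => Nat.floor_le_of_le
    ((div_le_iff₀ hh).2 (hK ▸ hs j hj))
  have key : ∑ i ∈ Finset.range K, (∑ j ∈ I, if i < ⌊s j / h⌋₊ then θ j else 0)
      * (increment b h i w + avgDrift b h i w * h)
      = ∑ j ∈ I, θ j * (noise b (⌊s j / h⌋₊ * h) w - noise b 0 w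
      + ∑ i ∈ Finset.range ⌊s j / h⌋₊, h * avgDrift b h i w) := by
    simp_rw [Finset.sum_mul]
    rw [Finset.sum_comm]
    refine Finset.sum_congr rfl fun j hj => ?_
    rw [← sum_increment, ← Finset.sum_add_distrib, Finset.mul_sum]
    simp_rw [ite_mul, zero_mul]
    rw [← Finset.sum_filter]
    refine Finset.sum_congr ?_ fun i _ => by ring
    ext i
    have := hk j hj
    simp only [Finset.mem_filter, Finset.mem_range]
    omega
  dsimp only
  rw [meshGirsanov, ← key, Complex.ofReal_exp, ← Complex.exp_add]
  congr 1
  rw [stepIntegral]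
  push_cast
  rw [Finset.sum_div, ← Finset.sum_neg_distrib, ← Finset.sum_sub_distrib, Finset.sum_mul,
    ← Finset.sum_add_distrib]
  refine Finset.sum_congr rfl fun i _ => ?_
  ring

/-- The limit of the densities of `meshGirsanov`, given the limit `J` of the step integrals. -/
noncomputable def density (b : ℝ → ℝ → ℝ) (T : ℝ) (J : PathSpace → ℝ) (w : PathSpace) : ℝ :=
  Real.exp (-J w - (∫ s in (0 : ℝ)..T, drift b s w ^ 2) / 2)

lemma measurable_density (hb : Measurable (Function.uncurry b)) (T : ℝ) {J : PathSpace → ℝ}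
    (hJ : Measurable J) : Measurable (density b T J) :=
  ((hJ.neg).sub ((measurable_intervalIntegral ((measurable_drift hb).pow_const 2) 0 T).div_const
    2)).exp

lemma tendsto_meshGirsanov (hb : Measurable (Function.uncurry b)) (hC : ∀ p q, |b p q| ≤ C)
    (hT : 0 < T) {J : PathSpace → ℝ} {φ : ℕ → ℕ} (hφ : StrictMono φ) {w : PathSpace}
    (hw : Tendsto (fun n => stepIntegral b (T / (φ n + 1 : ℕ)) (φ n + 1) w) atTop (𝓝 (J w)))
    {ι : Type*} (I : Finset ι) (s θ : ι → ℝ) (hs : ∀ j ∈ I, 0 ≤ s j) :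
    Tendsto (fun n => meshGirsanov b (T / (φ n + 1 : ℕ)) (φ n + 1) I s θ w) atTop
      (𝓝 (density b T J w * Complex.exp ((∑ j ∈ I, θ j * (w.1 (s j) - w.1 0) : ℝ) * Complex.I))) := by
  have hh : ∀ n, 0 < T / (φ n + 1 : ℕ) := fun n => by positivity
  have hlim := (tendsto_div_nat_succ T).comp hφ.tendsto_atTop
  have hq : Tendsto (fun n => ∑ i ∈ Finset.range (φ n + 1), T / (φ n + 1 : ℕ)
      * avgDrift b (T / (φ n + 1 : ℕ)) i w ^ 2) atTop (𝓝 (∫ s in (0 : ℝ)..T, drift b s w ^ 2)) := by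
    refine (tendsto_intervalIntegral_comp_stepDrift hb hC w hh hlim hT.le
      (Φ := fun p _ => p ^ 2) (by unfold Function.uncurry; fun_prop)).congr fun n => ?_
    have := (integral_comp_floor_div (hh n)
      (fun k => avgDrift b (T / (φ n + 1 : ℕ)) k w ^ 2) (φ n + 1)).2
    rw [mul_div_cancel₀ _ (by positivity)] at this
    exact this
  have hsum : Tendsto (fun n => ∑ j ∈ I, θ j * (noise b (⌊s j / (T / (φ n + 1 : ℕ))⌋₊
        * (T / (φ n + 1 : ℕ))) w - noise b 0 w
      + ∑ i ∈ Finset.range ⌊s j / (T / (φ n + 1 : ℕ))⌋₊, T / (φ n + 1 : ℕ)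
        * avgDrift b (T / (φ n + 1 : ℕ)) i w)) atTop
      (𝓝 (∑ j ∈ I, θ j * (w.1 (s j) - w.1 0))) := by
    refine tendsto_finsetSum _ fun j hj => ?_
    have e : w.1 (s j) - w.1 0
        = noise b (s j) w - noise b 0 w + ∫ u in (0 : ℝ)..(s j), drift b u w := by
      simp only [noise, intervalIntegral.integral_same]
      ring
    rw [e]
    exact (((((continuous_noise hb hC w).tendsto _).comp (tendsto_floor_div_mul hh hlim
      (hs j hj))).sub_const _).add (tendsto_sum_avgDrift hb hC w hh hlim (hs j hj))).const_mul _
  have h1 := (Real.continuous_exp.tendsto _).comp (hw.neg.sub (hq.div_const 2))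
  exact ((Complex.continuous_ofReal.tendsto _).comp h1).mul
    ((Complex.continuous_exp.tendsto _).comp
      (((Complex.continuous_ofReal.tendsto _).comp hsum).mul_const Complex.I))

lemma IsDriftedLaw.tendsto_integral_meshGirsanov [IsProbabilityMeasure μ]
    (hμ : IsDriftedLaw b x T μ)
    (hb : Measurable (Function.uncurry b)) (hC : ∀ p q, |b p q| ≤ C)
    (hT : 0 < T) {J : PathSpace → ℝ} {φ : ℕ → ℕ} (hφ : StrictMono φ)
    (hJ : ∀ᵐ w ∂μ,
      Tendsto (fun n => stepIntegral b (T / (φ n + 1 : ℕ)) (φ n + 1) w) atTop (𝓝 (J w)))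
    {ι : Type*} (I : Finset ι) (s θ : ι → ℝ) (hs : ∀ j ∈ I, 0 ≤ s j) :
    Integrable (fun w => density b T J w *
      Complex.exp ((∑ j ∈ I, θ j * (w.1 (s j) - w.1 0) : ℝ) * Complex.I)) μ ∧
    Tendsto (fun n => ∫ w, meshGirsanov b (T / (φ n + 1 : ℕ)) (φ n + 1) I s θ w ∂μ) atTop
      (𝓝 (∫ w, density b T J w *
        Complex.exp ((∑ j ∈ I, θ j * (w.1 (s j) - w.1 0) : ℝ) * Complex.I) ∂μ)) := by
  refine tendsto_integral_of_lintegral_sq_le (D := (Real.exp (T * C ^ 2)).toNNReal)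
    (fun n => (measurable_meshGirsanov hb _ _ I s θ).aestronglyMeasurable) (fun n => ?_)
    (hJ.mono fun w hw => tendsto_meshGirsanov hb hC hT hφ hw I s θ hs)
  have hh : 0 < T / (φ n + 1 : ℕ) := by positivity
  have hK : ((φ n + 1 : ℕ) : ℝ) * (T / (φ n + 1 : ℕ)) = T := mul_div_cancel₀ _ (by positivity)
  have := (hμ.gaussianIncrements hb hh.le hK.le).lintegral_girsanov_sq_le
    (fun _ _ => measurable_past_avgDrift hb hh.le le_rfl) (fun k w => abs_avgDrift_le hC hh k w)
  rw [Real.coe_toNNReal _ hh.le, ← mul_assoc, hK] at this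
  refine le_trans (le_of_eq ?_) this
  refine lintegral_congr fun w => ?_
  rw [enorm_meshGirsanov, ENNReal.ofReal_pow (Real.exp_pos _).le]
  rfl

lemma IsDriftedLaw.integral_density_mul_cexp [IsProbabilityMeasure μ]
    (hμ : IsDriftedLaw b x T μ) (J : PathSpace → ℝ) (I : Finset ℝ) (θ : ℝ → ℝ) :
    ∫ w, density b T J w * Complex.exp ((∑ j ∈ I, θ j * w.1 j : ℝ) * Complex.I) ∂μ
      = Complex.exp ((∑ j ∈ I, θ j * x : ℝ) * Complex.I) * ∫ w, density b T J w * Complex.exp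
        ((∑ j ∈ I, θ j * (w.1 (max 0 (min j T)) - w.1 0) : ℝ) * Complex.I) ∂μ := by
  rw [← integral_const_mul]
  refine integral_congr_ae ?_
  filter_upwards [(Finset.eventually_all I).2 fun j _ => hμ.clamp j, hμ.zero] with w hw h0
  have e : ∑ j ∈ I, θ j * w.1 j
      = ∑ j ∈ I, θ j * x + ∑ j ∈ I, θ j * (w.1 (max 0 (min j T)) - w.1 0) := by
    rw [← Finset.sum_add_distrib]
    refine Finset.sum_congr rfl fun j hj => ?_
    rw [h0, ← hw j hj]
    ring
  rw [mul_left_comm, ← Complex.exp_add, ← add_mul, ← Complex.ofReal_add, e]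

lemma integral_density_mul_cexp_eq [IsProbabilityMeasure μ] [IsProbabilityMeasure μ']
    (hμ : IsDriftedLaw b x T μ) (hμ' : IsDriftedLaw b x T μ')
    (hb : Measurable (Function.uncurry b)) (hC : ∀ p q, |b p q| ≤ C)
    (hT : 0 < T) {J : PathSpace → ℝ} {φ : ℕ → ℕ} (hφ : StrictMono φ)
    (hJ : ∀ᵐ w ∂(μ + μ'),
      Tendsto (fun n => stepIntegral b (T / (φ n + 1 : ℕ)) (φ n + 1) w) atTop (𝓝 (J w)))
    (I : Finset ℝ) (θ : ℝ → ℝ) :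
    ∫ w, density b T J w * Complex.exp ((∑ j ∈ I, θ j * w.1 j : ℝ) * Complex.I) ∂μ
      = ∫ w, density b T J w * Complex.exp ((∑ j ∈ I, θ j * w.1 j : ℝ) * Complex.I) ∂μ' := by
  rw [ae_add_measure_iff] at hJ
  rw [hμ.integral_density_mul_cexp, hμ'.integral_density_mul_cexp]
  congr 1
  have h1 := (hμ.tendsto_integral_meshGirsanov hb hC hT hφ hJ.1 I (fun j => max 0 (min j T)) θ
    fun j _ => le_max_left _ _).2
  have h2 := (hμ'.tendsto_integral_meshGirsanov hb hC hT hφ hJ.2 I (fun j => max 0 (min j T)) θ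
    fun j _ => le_max_left _ _).2
  refine tendsto_nhds_unique h1 (h2.congr fun n => ?_)
  have hK : ((φ n + 1 : ℕ) : ℝ) * (T / (φ n + 1 : ℕ)) = T := mul_div_cancel₀ _ (by positivity)
  rw [hμ.integral_meshGirsanov hb hC (by positivity) hK I _ θ fun j _ =>
      max_le hT.le (min_le_right _ _),
    hμ'.integral_meshGirsanov hb hC (by positivity) hK I _ θ fun j _ =>
      max_le hT.le (min_le_right _ _)]

lemma measure_ext_of_integral_cexp {ν ν' : Measure PathSpace} [IsFiniteMeasure ν]
    [IsFiniteMeasure ν'] (h : ∀ (I : Finset ℝ) (θ : ℝ → ℝ),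
      ∫ w, Complex.exp ((∑ j ∈ I, θ j * w.1 j : ℝ) * Complex.I) ∂ν
        = ∫ w, Complex.exp ((∑ j ∈ I, θ j * w.1 j : ℝ) * Complex.I) ∂ν') : ν = ν' := by
  have hval : Measurable fun w : PathSpace => w.1 := measurable_subtype_coe
  have hfin : IsProjectiveLimit (α := fun _ : ℝ => ℝ) (ν'.map fun w => w.1)
      fun I => (ν.map fun w => w.1).map I.restrict := fun I => by
    have hr : Measurable (I.restrict (π := fun _ => ℝ) ∘ fun w : PathSpace => w.1) :=
      (Finset.measurable_restrict I).comp hval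
    dsimp only
    rw [Measure.map_map (Finset.measurable_restrict I) hval,
      Measure.map_map (Finset.measurable_restrict I) hval]
    refine Measure.ext_of_charFunDual (funext fun L => ?_)
    rw [charFunDual_apply, charFunDual_apply,
      integral_map hr.aemeasurable (by fun_prop), integral_map hr.aemeasurable (by fun_prop)]
    have hL : ∀ w : PathSpace, L (I.restrict (π := fun _ => ℝ) w.1)
        = ∑ j ∈ I, L (fun i => if j = i.1 then 1 else 0) * w.1 j := fun w => by
      have := (L : (I → ℝ) →ₗ[ℝ] ℝ).pi_apply_eq_sum_univ (I.restrict (π := fun _ => ℝ) w.1)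
      refine this.trans ?_
      rw [← Finset.sum_coe_sort I]
      refine Finset.sum_congr rfl fun j _ => ?_
      simp only [Finset.restrict, smul_eq_mul, Subtype.ext_iff]
      exact mul_comm _ _
    simp only [Function.comp_def, hL]
    exact (h I _).symm
  have hmap : ν.map (fun w => w.1) = ν'.map fun w => w.1 :=
    IsProjectiveLimit.unique (fun _ => rfl) hfin
  ext A hA
  obtain ⟨B, hB, rfl⟩ := hA
  rw [← Measure.map_apply hval hB, hmap, Measure.map_apply hval hB]

theorem IsDriftedLaw.unique [IsProbabilityMeasure μ] [IsProbabilityMeasure μ']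
    (hμ : IsDriftedLaw b x T μ) (hμ' : IsDriftedLaw b x T μ')
    (hb : Measurable (Function.uncurry b)) (hC : ∀ p q, |b p q| ≤ C) (hT : 0 < T) : μ = μ' := by
  obtain ⟨φ, hφ, J, hJm, hJ⟩ := exists_subseq_tendsto_stepIntegral hμ hμ' hb hC hT
  have hJ' := ae_add_measure_iff.1 hJ
  have hint : ∀ {ρ : Measure PathSpace} [IsProbabilityMeasure ρ], IsDriftedLaw b x T ρ →
      (∀ᵐ w ∂ρ, Tendsto (fun n => stepIntegral b (T / (φ n + 1 : ℕ)) (φ n + 1) w) atTop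
        (𝓝 (J w))) → IsFiniteMeasure (ρ.withDensity fun w => ENNReal.ofReal (density b T J w)) := by
    intro ρ _ hρ hρJ
    have := (hρ.tendsto_integral_meshGirsanov hb hC hT hφ hρJ (∅ : Finset ℝ) id 0 (by simp)).1
    simp only [Finset.sum_empty, Complex.ofReal_zero, zero_mul, Complex.exp_zero, mul_one] at this
    exact isFiniteMeasure_withDensity_ofReal (this.re).2
  have hfin := hint hμ hJ'.1
  have hfin' := hint hμ' hJ'.2
  have hm : Measurable fun w => ENNReal.ofReal (density b T J w) :=
    (measurable_density hb T hJm).ennreal_ofReal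
  have hpos : ∀ w, 0 < density b T J w := fun w => Real.exp_pos _
  have heq : μ.withDensity (fun w => ENNReal.ofReal (density b T J w))
      = μ'.withDensity fun w => ENNReal.ofReal (density b T J w) := by
    refine measure_ext_of_integral_cexp fun I θ => ?_
    rw [integral_withDensity_eq_integral_toReal_smul hm (by simp),
      integral_withDensity_eq_integral_toReal_smul hm (by simp)]
    simp only [ENNReal.toReal_ofReal (hpos _).le, Complex.real_smul]
    exact integral_density_mul_cexp_eq hμ hμ' hb hC hT hφ hJ I θ
  rw [← withDensity_inv_same (μ := μ) hm (by simp [hpos]) (by simp), heq,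
    withDensity_inv_same (μ := μ') hm (by simp [hpos]) (by simp)]

/-- The paths of a continuous process on `[0, T]`, frozen outside this interval. -/
def ofProcess {Ω : Type*} (T : ℝ) {X : ℝ → Ω → ℝ} (hX : ∀ ω, Continuous fun t => X t ω) (ω : Ω) :
    PathSpace :=
  ⟨fun t => X (max 0 (min t T)) ω, (hX ω).comp (by fun_prop)⟩

section Transfer

variable {Ω : Type*} {m : MeasurableSpace Ω} {P : Measure Ω}
  {ℱ : Filtration ℝ m} {x T : ℝ} {b : ℝ → ℝ → ℝ} {X W : ℝ → Ω → ℝ}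

lemma measurable_freeze_ofProcess (hX : ∀ ω, Continuous fun t => X t ω) (hXa : Adapted ℱ X) {s : ℝ}
    (hs : 0 ≤ s) : Measurable[ℱ s] fun ω => freeze s (ofProcess T hX ω) := by
  refine @Measurable.subtype_mk _ _ (ℱ s) _ _ _ (@measurable_pi_lambda _ _ _ (ℱ s) _ _ fun u => ?_) _
  exact (hXa _).mono (ℱ.mono (max_le hs ((min_le_left _ _).trans (min_le_right _ _)))) le_rfl

lemma measurable_ofProcess (hX : ∀ ω, Continuous fun t => X t ω) (hXa : Adapted ℱ X) :
    Measurable (ofProcess T hX) :=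
  Measurable.subtype_mk (measurable_pi_lambda _ fun _ => (hXa _).mono (ℱ.le _) le_rfl)

lemma drift_ofProcess (hX : ∀ ω, Continuous fun t => X t ω) {s : ℝ} (hs : s ∈ Icc 0 T) (ω : Ω) :
    drift b s (ofProcess T hX ω) = b (X s ω) (sSup ((fun u => X u ω) '' Icc 0 s)) := by
  have e : ∀ u ∈ Icc 0 s, max 0 (min u T) = u := fun u hu => by
    rw [min_eq_left (hu.2.trans hs.2), max_eq_right hu.1]
  rw [drift, runningMax_eq_sSup _ hs.1]
  congr 1
  · simp only [ofProcess, e s ⟨hs.1, le_rfl⟩]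
  · congr 1
    refine image_congr fun u hu => ?_
    simp only [ofProcess, e u hu]

lemma noise_ofProcess (hX : ∀ ω, Continuous fun t => X t ω) {ω : Ω}
    (hω : ∀ t : ℝ, 0 ≤ t → X t ω = x + W t ω +
      ∫ s in (0:ℝ)..t, b (X s ω) (sSup ((fun u => X u ω) '' Icc 0 s)))
    {t : ℝ} (ht : t ∈ Icc 0 T) : noise b t (ofProcess T hX ω) = x + W t ω := by
  have h : ∫ s in (0 : ℝ)..t, drift b s (ofProcess T hX ω)
      = ∫ s in (0:ℝ)..t, b (X s ω) (sSup ((fun u => X u ω) '' Icc 0 s)) := by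
    refine intervalIntegral.integral_congr fun s hs => ?_
    rw [uIcc_of_le ht.1] at hs
    exact drift_ofProcess hX ⟨hs.1, hs.2.trans ht.2⟩ ω
  rw [noise, h]
  simp only [ofProcess, min_eq_left ht.2, max_eq_right ht.1]
  linarith [hω t ht.1]

lemma isDriftedLaw_map_ofProcess (hb : Measurable (Function.uncurry b)) (hT : 0 ≤ T)
    (hXW : IsWeakSolutionMaxDrift P ℱ x b X W) :
    IsDriftedLaw b x T (P.map (ofProcess T hXW.1)) := by
  obtain ⟨hX, hXa, ⟨-, hW0, hWa, hind, hlaw⟩, heq⟩ := hXW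
  have hm : Measurable (ofProcess T hX) := measurable_ofProcess hX hXa
  have hincm : ∀ s t, Measurable fun w => noise b t w - noise b s w := fun s t =>
    (measurable_noise hb t).sub (measurable_noise hb s)
  have hinc : ∀ s t, 0 ≤ s → s ≤ t → t ≤ T →
      (fun ω => noise b t (ofProcess T hX ω) - noise b s (ofProcess T hX ω))
        =ᵐ[P] fun ω => W t ω - W s ω := fun s t hs hst ht => by
    filter_upwards [heq] with ω hω
    rw [noise_ofProcess hX hω ⟨hs, hst.trans ht⟩, noise_ofProcess hX hω ⟨hs.trans hst, ht⟩]
    ring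
  refine ⟨?_, ?_, fun s t hs hst ht => ?_, fun s t hs hst ht => ?_⟩
  · have hcl : ∀ r, max 0 (min (max 0 (min r T)) T) = max 0 (min r T) := fun r => by
      rw [min_eq_left (max_le hT (min_le_right _ _)), max_eq_right (le_max_left _ _)]
    refine fun t => (ae_map_iff hm.aemeasurable (measurableSet_eq_fun (measurable_eval t)
      (measurable_eval _))).2 (ae_of_all _ fun ω => ?_)
    simp only [ofProcess, hcl]
  · refine (ae_map_iff hm.aemeasurable (measurable_eval 0 (measurableSet_singleton x))).2 ?_
    filter_upwards [heq] with ω hω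
    have := hω 0 le_rfl
    simp only [intervalIntegral.integral_same, hW0, add_zero] at this
    simpa [ofProcess, hT] using this
  · rw [Indep_iff]
    rintro _ _ ⟨A, hA, rfl⟩ ⟨B, hB, rfl⟩
    have hA' := hincm s t hA
    have hB' := measurable_freeze s hB
    rw [Measure.map_apply hm hA', Measure.map_apply hm hB', Measure.map_apply hm (hA'.inter hB')]
    have hset : ofProcess T hX ⁻¹' ((fun w => noise b t w - noise b s w) ⁻¹' A)
        =ᵐ[P] (fun ω => W t ω - W s ω) ⁻¹' A := by
      filter_upwards [hinc s t hs hst ht] with ω hω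
      exact congrArg (· ∈ A) hω
    rw [preimage_inter, measure_congr hset]
    refine (measure_congr (hset.inter (ae_eq_refl (ofProcess T hX ⁻¹' (freeze s ⁻¹' B))))).trans ?_
    exact (Indep_iff _ _ _).1 (hind s t hs hst) _ _ ⟨A, hA, rfl⟩
      (measurable_freeze_ofProcess hX hXa hs hB)
  · rw [Measure.map_map (hincm s t) hm]
    exact (Measure.map_congr (hinc s t hs hst ht)).trans (hlaw s t hs hst)

end Transfer

end PathSpace

/-- Uniqueness in law for the SDE
`X_t = x + W_t + ∫_0^t b(X_s, max_{0≤u≤s} X_u) ds` with `b` bounded, measurable and, in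
its second variable, strictly increasing on `{y : y ≥ x'}` for each fixed first
variable `x'`: any two weak solutions, possibly on different filtered probability
spaces, have the same finite-dimensional distributions. -/
theorem uniqueness_in_law_sde_max_drift
    {Ω : Type*} {m : MeasurableSpace Ω} (P : Measure Ω) [IsProbabilityMeasure P]
    {Ω' : Type*} {m' : MeasurableSpace Ω'} (P' : Measure Ω') [IsProbabilityMeasure P']
    (ℱ : Filtration ℝ m) (ℱ' : Filtration ℝ m')
    (x : ℝ) (b : ℝ → ℝ → ℝ)
    (hb_meas : Measurable (Function.uncurry b))
    (hb_bdd : ∃ C : ℝ, ∀ p q : ℝ, |b p q| ≤ C)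
    (hb_mono : ∀ x' : ℝ, StrictMonoOn (b x') (Set.Ici x'))
    (X W : ℝ → Ω → ℝ) (X' W' : ℝ → Ω' → ℝ)
    (hXW : IsWeakSolutionMaxDrift P ℱ x b X W)
    (hX'W' : IsWeakSolutionMaxDrift P' ℱ' x b X' W') :
    ∀ (n : ℕ) (t : Fin n → ℝ), (∀ i, 0 ≤ t i) → StrictMono t →
      P.map (fun ω i => X (t i) ω) = P'.map (fun ω i => X' (t i) ω) := by
  obtain ⟨C, hC⟩ := hb_bdd
  intro n t ht0 _
  obtain ⟨T, hT⟩ : ∃ T, 0 < T ∧ ∀ i, t i ≤ T := by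
    obtain ⟨M, hM⟩ := (finite_range t).bddAbove
    exact ⟨max M 1, by positivity, fun i => (hM (mem_range_self i)).trans (le_max_left _ _)⟩
  have hm := PathSpace.measurable_ofProcess (T := T) hXW.1 hXW.2.1
  have hm' := PathSpace.measurable_ofProcess (T := T) hX'W'.1 hX'W'.2.1
  have hprob := Measure.isProbabilityMeasure_map (μ := P) hm.aemeasurable
  have hprob' := Measure.isProbabilityMeasure_map (μ := P') hm'.aemeasurable
  have hlaw := (PathSpace.isDriftedLaw_map_ofProcess hb_meas hT.1.le hXW).unique
    (PathSpace.isDriftedLaw_map_ofProcess hb_meas hT.1.le hX'W') hb_meas hC hT.1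
  have heval : Measurable fun (w : PathSpace) i => w.1 (t i) :=
    measurable_pi_lambda _ fun i => PathSpace.measurable_eval (t i)
  have key := congrArg (Measure.map fun (w : PathSpace) i => w.1 (t i)) hlaw
  rw [Measure.map_map heval hm, Measure.map_map heval hm'] at key
  have hcl : ∀ i, max 0 (min (t i) T) = t i := fun i => by
    rw [min_eq_left (hT.2 i), max_eq_right (ht0 i)]
  simpa only [Function.comp_def, PathSpace.ofProcess, hcl] using key
end

section
/- Let α < 1 and β ∈ ℝ, let y : [0,∞) → ℝ be continuous, and let x : [0,∞) → ℝ be a continuous function satisfying x_t = y_t + α·M^x_t + β·I^x_t for all t ≥ 0, where M^x_t = sup_{0≤s≤t} x_s and I^x_t = inf_{0≤s≤t} x_s. Then for every t ≥ 0, (1−α)·M^x_t = sup_{0≤s≤t} ( y_s + β·I^x_s ). -/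
open Set

/-- If `x` is a continuous solution on `[0,∞)` of the doubly perturbed
path equation `x_t = y_t + α·M^x_t + β·I^x_t` with `α < 1` and continuous driver `y`,
then `(1-α)·M^x_t = sup_{0≤s≤t} (y_s + β·I^x_s)` for every `t ≥ 0`. -/
theorem doubly_perturbed_running_max_identity
    (α β : ℝ) (hα : α < 1)
    (y : ℝ → ℝ) (hy : ContinuousOn y (Set.Ici 0))
    (x : ℝ → ℝ) (hx_cont : ContinuousOn x (Set.Ici 0))
    (hx : ∀ t : ℝ, 0 ≤ t →
      x t = y t + α * sSup (x '' Set.Icc 0 t) + β * sInf (x '' Set.Icc 0 t)) :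
    ∀ t : ℝ, 0 ≤ t →
      (1 - α) * sSup (x '' Set.Icc 0 t) =
        sSup ((fun s => y s + β * sInf (x '' Set.Icc 0 s)) '' Set.Icc 0 t) := by
  intro t ht
  have bdd : ∀ s : ℝ, BddAbove (x '' Set.Icc 0 s) := fun s =>
    (isCompact_Icc.image_of_continuousOn (hx_cont.mono Set.Icc_subset_Ici_self)).bddAbove
  obtain ⟨u, hu, hmax⟩ := isCompact_Icc.exists_isMaxOn (Set.nonempty_Icc.2 ht)
    (hx_cont.mono Set.Icc_subset_Ici_self)
  have sup_eq : ∀ s ∈ Set.Icc u t, sSup (x '' Set.Icc 0 s) = x u := fun s hs =>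
    IsGreatest.csSup_eq ⟨⟨u, ⟨hu.1, hs.1⟩, rfl⟩, by
      rintro _ ⟨r, hr, rfl⟩
      exact hmax ⟨hr.1, hr.2.trans hs.2⟩⟩
  rw [sup_eq t ⟨hu.2, le_rfl⟩]
  symm
  apply IsGreatest.csSup_eq
  refine ⟨⟨u, hu, ?_⟩, ?_⟩
  · have h := hx u hu.1
    rw [sup_eq u ⟨le_rfl, hu.2⟩] at h
    dsimp only
    linarith
  · rintro _ ⟨s, hs, rfl⟩
    have h := hx s hs.1
    have h_le : x s ≤ sSup (x '' Set.Icc 0 s) := le_csSup (bdd s) ⟨s, ⟨hs.1, le_rfl⟩, rfl⟩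
    have h_sup : sSup (x '' Set.Icc 0 s) ≤ x u := by
      rw [← sup_eq t ⟨hu.2, le_rfl⟩]
      exact csSup_le_csSup (bdd t) ((Set.nonempty_Icc.2 hs.1).image x)
        (Set.image_mono (Set.Icc_subset_Icc_right hs.2))
    have h_mul := mul_le_mul_of_nonneg_left h_sup (sub_nonneg.2 hα.le)
    dsimp only
    linarith
end

section
/- Let α ∈ ℝ and β < 1, let y : [0,∞) → ℝ be continuous, and let x : [0,∞) → ℝ be a continuous function satisfying x_t = y_t + α·M^x_t + β·I^x_t for all t ≥ 0, where M^x_t = sup_{0≤s≤t} x_s and I^x_t = inf_{0≤s≤t} x_s. Then for every t ≥ 0, (1−β)·I^x_t = inf_{0≤s≤t} ( y_s + α·M^x_s ). -/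
open Set

/-- If `x` is a continuous solution on `[0,∞)` of the doubly perturbed
path equation `x_t = y_t + α·M^x_t + β·I^x_t` with `β < 1` and continuous driver `y`,
then `(1-β)·I^x_t = inf_{0≤s≤t} (y_s + α·M^x_s)` for every `t ≥ 0`. -/
theorem doubly_perturbed_running_min_identity
    (α β : ℝ) (hβ : β < 1)
    (y : ℝ → ℝ) (hy : ContinuousOn y (Set.Ici 0))
    (x : ℝ → ℝ) (hx_cont : ContinuousOn x (Set.Ici 0))
    (hx : ∀ t : ℝ, 0 ≤ t →
      x t = y t + α * sSup (x '' Set.Icc 0 t) + β * sInf (x '' Set.Icc 0 t)) :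
    ∀ t : ℝ, 0 ≤ t →
      (1 - β) * sInf (x '' Set.Icc 0 t) =
        sInf ((fun s => y s + α * sSup (x '' Set.Icc 0 s)) '' Set.Icc 0 t) := by
  intro t ht
  have hc : ∀ s : ℝ, IsCompact (x '' Icc 0 s) := fun s =>
    isCompact_Icc.image_of_continuousOn (hx_cont.mono Icc_subset_Ici_self)
  have hle : ∀ {r s : ℝ}, r ∈ Icc 0 s → sInf (x '' Icc 0 s) ≤ x r := fun hr =>
    csInf_le (hc _).bddBelow (mem_image_of_mem x hr)
  have hanti : ∀ {s : ℝ}, s ∈ Icc 0 t → sInf (x '' Icc 0 t) ≤ sInf (x '' Icc 0 s) := fun hs =>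
    csInf_le_csInf (hc t).bddBelow ((nonempty_Icc.2 hs.1).image x)
      (image_mono (Icc_subset_Icc_right hs.2))
  symm
  apply IsLeast.csInf_eq
  constructor
  · obtain ⟨s, hs, hmin⟩ := (hc t).sInf_mem ((nonempty_Icc.2 ht).image x)
    have h : sInf (x '' Icc 0 s) = sInf (x '' Icc 0 t) :=
      le_antisymm (hmin ▸ hle (right_mem_Icc.2 hs.1)) (hanti hs)
    refine ⟨s, hs, ?_⟩
    have hxs := hx s hs.1
    rw [h, hmin] at hxs
    dsimp only
    linarith
  · rintro _ ⟨s, hs, rfl⟩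
    have hxs := hx s hs.1
    have hself := hle (right_mem_Icc.2 hs.1)
    have hmul := mul_le_mul_of_nonneg_left (hanti hs) (sub_nonneg.2 hβ.le)
    dsimp only
    linarith
end

section
/- Let α < 1 and β < 1, let y¹, y² : [0,∞) → ℝ be continuous, and for i = 1,2 let xⁱ be a continuous function satisfying xⁱ_t = yⁱ_t + α·M^{xⁱ}_t + β·I^{xⁱ}_t for all t ≥ 0, where M and I denote the running maximum and minimum. Then for every t ≥ 0, writing a(t) = sup_{0≤s≤t} |y¹_s − y²_s|, one has sup_{0≤s≤t} |M^{x¹}_s − M^{x²}_s| ≤ (1/(1−α))·a(t) + (|β|/(1−α))·sup_{0≤s≤t} |I^{x¹}_s − I^{x²}_s|, and sup_{0≤s≤t} |I^{x¹}_s − I^{x²}_s| ≤ (1/(1−β))·a(t) + (|α|/(1−β))·sup_{0≤s≤t} |M^{x¹}_s − M^{x²}_s|. -/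
open Set

/-- A continuous path `x` on `[0, ∞)` has bounded image on `[0, t]`. -/
lemma exists_abs_le_of_continuousOn_Ici {x : ℝ → ℝ} (hx : ContinuousOn x (Set.Ici 0)) (t : ℝ) :
    ∃ C, ∀ s ∈ Set.Icc 0 t, |x s| ≤ C :=
  isCompact_Icc.exists_bound_of_continuousOn (hx.mono Set.Icc_subset_Ici_self)

lemma sInf_image_eq_neg_sSup_image_neg (x : ℝ → ℝ) (s : Set ℝ) :
    sInf (x '' s) = -sSup ((-x) '' s) := by
  rw [Real.sInf_def, ← Set.image_neg_eq_neg, Set.image_image]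
  rfl

/-- The running maximum of a continuous path is locally bounded. -/
lemma exists_abs_sSup_image_le {x : ℝ → ℝ} (hx : ContinuousOn x (Set.Ici 0)) (t : ℝ) :
    ∃ C, ∀ s ∈ Set.Icc 0 t, |sSup (x '' Set.Icc 0 s)| ≤ C := by
  obtain ⟨C, hC⟩ := exists_abs_le_of_continuousOn_Ici hx t
  refine ⟨C, fun s hs => ?_⟩
  obtain ⟨r, hr, hr'⟩ := isCompact_Icc.exists_sSup_image_eq (Set.nonempty_Icc.2 hs.1)
    (hx.mono Set.Icc_subset_Ici_self)
  rw [hr']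
  exact hC r ⟨hr.1, hr.2.trans hs.2⟩

/-- The running minimum of a continuous path is locally bounded. -/
lemma exists_abs_sInf_image_le {x : ℝ → ℝ} (hx : ContinuousOn x (Set.Ici 0)) (t : ℝ) :
    ∃ C, ∀ s ∈ Set.Icc 0 t, |sInf (x '' Set.Icc 0 s)| ≤ C := by
  obtain ⟨C, hC⟩ := exists_abs_sSup_image_le hx.neg t
  refine ⟨C, fun s hs => ?_⟩
  rw [sInf_image_eq_neg_sSup_image_neg, abs_neg]
  exact hC s hs

lemma abs_sub_le_sSup_image {f g : ℝ → ℝ} {t : ℝ} (hf : ∃ C, ∀ s ∈ Set.Icc 0 t, |f s| ≤ C)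
    (hg : ∃ C, ∀ s ∈ Set.Icc 0 t, |g s| ≤ C) {s : ℝ} (hs : s ∈ Set.Icc 0 t) :
    |f s - g s| ≤ sSup ((fun r => |f r - g r|) '' Set.Icc 0 t) := by
  obtain ⟨C, hC⟩ := hf
  obtain ⟨D, hD⟩ := hg
  refine le_csSup ⟨C + D, ?_⟩ ⟨s, hs, rfl⟩
  rintro _ ⟨r, hr, rfl⟩
  exact (abs_sub _ _).trans (add_le_add (hC r hr) (hD r hr))

/-- One-sided comparison of the running maxima of two solutions of `x = z + α M`. -/
lemma perturbed_max_sub_le {α c t : ℝ} (hα : α < 1) (ht : 0 ≤ t) {x₁ x₂ z₁ z₂ : ℝ → ℝ}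
    (hc₁ : ContinuousOn x₁ (Set.Ici 0)) (hc₂ : ContinuousOn x₂ (Set.Ici 0))
    (hx₁ : ∀ s, 0 ≤ s → x₁ s = z₁ s + α * sSup (x₁ '' Set.Icc 0 s))
    (hx₂ : ∀ s, 0 ≤ s → x₂ s = z₂ s + α * sSup (x₂ '' Set.Icc 0 s))
    (hz : ∀ s ∈ Set.Icc 0 t, z₁ s - z₂ s ≤ c) :
    (1 - α) * (sSup (x₁ '' Set.Icc 0 t) - sSup (x₂ '' Set.Icc 0 t)) ≤ c := by
  have hbdd : ∀ {x : ℝ → ℝ}, ContinuousOn x (Set.Ici 0) → ∀ s, BddAbove (x '' Set.Icc 0 s) :=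
    fun h s => isCompact_Icc.bddAbove_image (h.mono Set.Icc_subset_Ici_self)
  obtain ⟨r, hr, hr'⟩ := isCompact_Icc.exists_sSup_image_eq (Set.nonempty_Icc.2 ht)
    (hc₁.mono Set.Icc_subset_Ici_self)
  have hrr : r ∈ Set.Icc 0 r := ⟨hr.1, le_rfl⟩
  have hmono : ∀ {x : ℝ → ℝ}, ContinuousOn x (Set.Ici 0) →
      sSup (x '' Set.Icc 0 r) ≤ sSup (x '' Set.Icc 0 t) := fun h =>
    csSup_le_csSup (hbdd h t) ⟨_, r, hrr, rfl⟩
      (Set.image_mono (Set.Icc_subset_Icc_right hr.2))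
  have hmax : sSup (x₁ '' Set.Icc 0 r) = x₁ r :=
    le_antisymm (hr' ▸ hmono hc₁) (le_csSup (hbdd hc₁ r) ⟨r, hrr, rfl⟩)
  have e₁ := hx₁ r hr.1
  have e₂ := hx₂ r hr.1
  have hle : x₂ r ≤ sSup (x₂ '' Set.Icc 0 r) := le_csSup (hbdd hc₂ r) ⟨r, hrr, rfl⟩
  have hmul := mul_le_mul_of_nonneg_left (hmono hc₂) (sub_nonneg.2 hα.le)
  have hzr := hz r hr
  rw [hmax] at e₁
  rw [hr']
  linarith

/-- Comparison of the running maxima of two solutions of `x = y + α M + γ w`. -/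
lemma perturbed_max_sSup_abs_sub_le {α γ t : ℝ} (hα : α < 1) (ht : 0 ≤ t)
    {x₁ x₂ y₁ y₂ w₁ w₂ : ℝ → ℝ}
    (hc₁ : ContinuousOn x₁ (Set.Ici 0)) (hc₂ : ContinuousOn x₂ (Set.Ici 0))
    (hx₁ : ∀ s, 0 ≤ s → x₁ s = y₁ s + γ * w₁ s + α * sSup (x₁ '' Set.Icc 0 s))
    (hx₂ : ∀ s, 0 ≤ s → x₂ s = y₂ s + γ * w₂ s + α * sSup (x₂ '' Set.Icc 0 s))
    {a b : ℝ} (ha : ∀ s ∈ Set.Icc 0 t, |y₁ s - y₂ s| ≤ a)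
    (hb : ∀ s ∈ Set.Icc 0 t, |w₁ s - w₂ s| ≤ b) :
    sSup ((fun s => |sSup (x₁ '' Set.Icc 0 s) - sSup (x₂ '' Set.Icc 0 s)|) '' Set.Icc 0 t) ≤
      (1 / (1 - α)) * a + (|γ| / (1 - α)) * b := by
  have hα' : 0 < 1 - α := sub_pos.2 hα
  have hz : ∀ s ∈ Set.Icc 0 t, |(y₁ s + γ * w₁ s) - (y₂ s + γ * w₂ s)| ≤ a + |γ| * b := by
    intro s hs
    calc |(y₁ s + γ * w₁ s) - (y₂ s + γ * w₂ s)|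
        = |(y₁ s - y₂ s) + γ * (w₁ s - w₂ s)| := by ring_nf
      _ ≤ |y₁ s - y₂ s| + |γ| * |w₁ s - w₂ s| := by
          rw [← abs_mul]; exact abs_add_le _ _
      _ ≤ a + |γ| * b := by
          gcongr
          · exact ha s hs
          · exact hb s hs
  refine csSup_le ((Set.nonempty_Icc.2 ht).image _) ?_
  rintro _ ⟨s, hs, rfl⟩
  have hsub : ∀ r ∈ Set.Icc 0 s, r ∈ Set.Icc 0 t := fun r hr => ⟨hr.1, hr.2.trans hs.2⟩
  have h₁ := perturbed_max_sub_le hα hs.1 hc₁ hc₂ hx₁ hx₂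
    fun r hr => (abs_le.1 (hz r (hsub r hr))).2
  have h₂ := perturbed_max_sub_le hα hs.1 hc₂ hc₁ hx₂ hx₁ (c := a + |γ| * b)
    fun r hr => by linarith [(abs_le.1 (hz r (hsub r hr))).1]
  have hrw : (1 / (1 - α)) * a + (|γ| / (1 - α)) * b = (a + |γ| * b) / (1 - α) := by ring
  rw [hrw, abs_le, neg_le, le_div_iff₀' hα', le_div_iff₀' hα', neg_sub]
  exact ⟨h₂, h₁⟩

/-- Stability estimates for the running maximum and minimum of two
continuous solutions `x¹, x²` of the doubly perturbed path equation
`xⁱ_t = yⁱ_t + α·M^{xⁱ}_t + β·I^{xⁱ}_t` (`α < 1`, `β < 1`), in terms of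
`a(t) = sup_{0≤s≤t} |y¹_s − y²_s|`. -/
theorem doubly_perturbed_max_min_stability
    (α β : ℝ) (hα : α < 1) (hβ : β < 1)
    (y₁ y₂ : ℝ → ℝ)
    (hy₁ : ContinuousOn y₁ (Set.Ici 0)) (hy₂ : ContinuousOn y₂ (Set.Ici 0))
    (x₁ x₂ : ℝ → ℝ)
    (hx₁_cont : ContinuousOn x₁ (Set.Ici 0)) (hx₂_cont : ContinuousOn x₂ (Set.Ici 0))
    (hx₁ : ∀ t : ℝ, 0 ≤ t →
      x₁ t = y₁ t + α * sSup (x₁ '' Set.Icc 0 t) + β * sInf (x₁ '' Set.Icc 0 t))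
    (hx₂ : ∀ t : ℝ, 0 ≤ t →
      x₂ t = y₂ t + α * sSup (x₂ '' Set.Icc 0 t) + β * sInf (x₂ '' Set.Icc 0 t)) :
    ∀ t : ℝ, 0 ≤ t →
      (sSup ((fun s => |sSup (x₁ '' Set.Icc 0 s) - sSup (x₂ '' Set.Icc 0 s)|) ''
          Set.Icc 0 t) ≤
        (1 / (1 - α)) * sSup ((fun s => |y₁ s - y₂ s|) '' Set.Icc 0 t) +
          (|β| / (1 - α)) *
            sSup ((fun s => |sInf (x₁ '' Set.Icc 0 s) - sInf (x₂ '' Set.Icc 0 s)|) ''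
              Set.Icc 0 t)) ∧
      (sSup ((fun s => |sInf (x₁ '' Set.Icc 0 s) - sInf (x₂ '' Set.Icc 0 s)|) ''
          Set.Icc 0 t) ≤
        (1 / (1 - β)) * sSup ((fun s => |y₁ s - y₂ s|) '' Set.Icc 0 t) +
          (|α| / (1 - β)) *
            sSup ((fun s => |sSup (x₁ '' Set.Icc 0 s) - sSup (x₂ '' Set.Icc 0 s)|) ''
              Set.Icc 0 t)) := by
  intro t ht
  have hy := fun s (hs : s ∈ Set.Icc 0 t) => abs_sub_le_sSup_image
    (exists_abs_le_of_continuousOn_Ici hy₁ t) (exists_abs_le_of_continuousOn_Ici hy₂ t) hs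
  refine ⟨perturbed_max_sSup_abs_sub_le hα ht hx₁_cont hx₂_cont
    (fun s hs => by linarith [hx₁ s hs]) (fun s hs => by linarith [hx₂ s hs]) hy
    fun s hs => abs_sub_le_sSup_image (exists_abs_sInf_image_le hx₁_cont t)
      (exists_abs_sInf_image_le hx₂_cont t) hs, ?_⟩
  have h := perturbed_max_sSup_abs_sub_le (γ := -α) (y₁ := fun s => -y₁ s) (y₂ := fun s => -y₂ s)
    (w₁ := fun s => sSup (x₁ '' Set.Icc 0 s)) (w₂ := fun s => sSup (x₂ '' Set.Icc 0 s))
    hβ ht hx₁_cont.neg hx₂_cont.neg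
    (fun s hs => by
      have := hx₁ s hs
      rw [sInf_image_eq_neg_sSup_image_neg] at this
      rw [Pi.neg_apply]
      linarith)
    (fun s hs => by
      have := hx₂ s hs
      rw [sInf_image_eq_neg_sSup_image_neg] at this
      rw [Pi.neg_apply]
      linarith)
    (fun s hs => by
      rw [neg_sub_neg, abs_sub_comm]
      exact hy s hs)
    fun s hs => abs_sub_le_sSup_image (exists_abs_sSup_image_le hx₁_cont t)
      (exists_abs_sSup_image_le hx₂_cont t) hs
  rw [abs_neg] at h
  simpa only [sInf_image_eq_neg_sSup_image_neg, neg_sub_neg, abs_sub_comm] using h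
end

section
/- Let α < 1 and β < 1 satisfy |αβ| < (1−α)(1−β), let y¹, y² : [0,∞) → ℝ be continuous, and for i = 1,2 let xⁱ be a continuous function satisfying xⁱ_t = yⁱ_t + α·M^{xⁱ}_t + β·I^{xⁱ}_t for all t ≥ 0. Then for every t ≥ 0, ( 1 − |αβ|/((1−α)(1−β)) ) · sup_{0≤s≤t} |M^{x¹}_s − M^{x²}_s| ≤ (1/(1−α))·( 1 + |β|/(1−β) ) · sup_{0≤s≤t} |y¹_s − y²_s|. -/
open Set

/-- A function continuous on `[0, ∞)` has a maximum point on `[0, t]`. -/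
lemma exists_eq_runningMax {x : ℝ → ℝ} (hx : ContinuousOn x (Set.Ici 0)) {t : ℝ} (ht : 0 ≤ t) :
    ∃ s ∈ Set.Icc 0 t, x s = sSup (x '' Set.Icc 0 t) := by
  obtain ⟨s, hs, h, -⟩ := isCompact_Icc.exists_sSup_image_eq_and_ge (Set.nonempty_Icc.2 ht)
    (hx.mono Set.Icc_subset_Ici_self)
  exact ⟨s, hs, h.symm⟩

lemma le_runningMax {x : ℝ → ℝ} (hx : ContinuousOn x (Set.Ici 0)) {s t : ℝ}
    (hs : s ∈ Set.Icc 0 t) : x s ≤ sSup (x '' Set.Icc 0 t) :=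
  le_csSup (isCompact_Icc.bddAbove_image (hx.mono Set.Icc_subset_Ici_self))
    (Set.mem_image_of_mem x hs)

lemma runningMax_mono {x : ℝ → ℝ} (hx : ContinuousOn x (Set.Ici 0)) {s t : ℝ}
    (hs : 0 ≤ s) (hst : s ≤ t) : sSup (x '' Set.Icc 0 s) ≤ sSup (x '' Set.Icc 0 t) := by
  obtain ⟨u, hu, hxu⟩ := exists_eq_runningMax hx hs
  exact hxu ▸ le_runningMax hx ⟨hu.1, hu.2.trans hst⟩

lemma runningMax_neg (x : ℝ → ℝ) (t : ℝ) :
    sSup ((-x) '' Set.Icc 0 t) = -sInf (x '' Set.Icc 0 t) := by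
  rw [Real.sInf_def, neg_neg, ← Set.image_neg_eq_neg, Set.image_image]
  rfl

/-- One-sided comparison of the running maxima of two singly perturbed paths. -/
lemma runningMax_sub_le {α C t : ℝ} (hα : α < 1) (ht : 0 ≤ t) {x₁ x₂ z₁ z₂ : ℝ → ℝ}
    (hc₁ : ContinuousOn x₁ (Set.Ici 0)) (hc₂ : ContinuousOn x₂ (Set.Ici 0))
    (h₁ : ∀ s, 0 ≤ s → x₁ s = z₁ s + α * sSup (x₁ '' Set.Icc 0 s))
    (h₂ : ∀ s, 0 ≤ s → x₂ s = z₂ s + α * sSup (x₂ '' Set.Icc 0 s))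
    (hz : ∀ s ∈ Set.Icc 0 t, z₁ s - z₂ s ≤ C) :
    (1 - α) * (sSup (x₁ '' Set.Icc 0 t) - sSup (x₂ '' Set.Icc 0 t)) ≤ C := by
  obtain ⟨s, hs, hxs⟩ := exists_eq_runningMax hc₁ ht
  have hmax : sSup (x₁ '' Set.Icc 0 s) = sSup (x₁ '' Set.Icc 0 t) :=
    le_antisymm (runningMax_mono hc₁ hs.1 hs.2) (hxs ▸ le_runningMax hc₁ ⟨hs.1, le_rfl⟩)
  have e₁ := h₁ s hs.1
  rw [hmax, hxs] at e₁
  have e₂ := h₂ s hs.1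
  have hx₂ : x₂ s ≤ sSup (x₂ '' Set.Icc 0 s) := le_runningMax hc₂ ⟨hs.1, le_rfl⟩
  have hmono := mul_le_mul_of_nonneg_left (runningMax_mono hc₂ hs.1 hs.2) (sub_nonneg.2 hα.le)
  linarith [hz s hs]

/-- Comparison of the running maxima of two singly perturbed paths. -/
lemma abs_runningMax_sub_le {α C t : ℝ} (hα : α < 1) (ht : 0 ≤ t) {x₁ x₂ z₁ z₂ : ℝ → ℝ}
    (hc₁ : ContinuousOn x₁ (Set.Ici 0)) (hc₂ : ContinuousOn x₂ (Set.Ici 0))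
    (h₁ : ∀ s, 0 ≤ s → x₁ s = z₁ s + α * sSup (x₁ '' Set.Icc 0 s))
    (h₂ : ∀ s, 0 ≤ s → x₂ s = z₂ s + α * sSup (x₂ '' Set.Icc 0 s))
    (hz : ∀ s ∈ Set.Icc 0 t, |z₁ s - z₂ s| ≤ C) :
    |sSup (x₁ '' Set.Icc 0 t) - sSup (x₂ '' Set.Icc 0 t)| ≤ C / (1 - α) := by
  have hα' : 0 < 1 - α := sub_pos.2 hα
  rw [abs_le', neg_sub, le_div_iff₀' hα', le_div_iff₀' hα']
  exact ⟨runningMax_sub_le hα ht hc₁ hc₂ h₁ h₂ fun s hs => (le_abs_self _).trans (hz s hs),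
    runningMax_sub_le hα ht hc₂ hc₁ h₂ h₁ fun s hs =>
      (le_abs_self _).trans (abs_sub_comm (z₁ s) (z₂ s) ▸ hz s hs)⟩

/-- Comparison of the running minima of two singly perturbed paths. -/
lemma abs_runningMin_sub_le {β C t : ℝ} (hβ : β < 1) (ht : 0 ≤ t) {x₁ x₂ z₁ z₂ : ℝ → ℝ}
    (hc₁ : ContinuousOn x₁ (Set.Ici 0)) (hc₂ : ContinuousOn x₂ (Set.Ici 0))
    (h₁ : ∀ s, 0 ≤ s → x₁ s = z₁ s + β * sInf (x₁ '' Set.Icc 0 s))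
    (h₂ : ∀ s, 0 ≤ s → x₂ s = z₂ s + β * sInf (x₂ '' Set.Icc 0 s))
    (hz : ∀ s ∈ Set.Icc 0 t, |z₁ s - z₂ s| ≤ C) :
    |sInf (x₁ '' Set.Icc 0 t) - sInf (x₂ '' Set.Icc 0 t)| ≤ C / (1 - β) := by
  have h := abs_runningMax_sub_le (z₁ := fun s => -z₁ s) (z₂ := fun s => -z₂ s) (C := C)
    hβ ht hc₁.neg hc₂.neg
    (fun s hs => by rw [runningMax_neg, Pi.neg_apply, h₁ s hs]; ring)
    (fun s hs => by rw [runningMax_neg, Pi.neg_apply, h₂ s hs]; ring)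
    (fun s hs => by rw [← neg_sub', abs_neg]; exact hz s hs)
  rwa [runningMax_neg, runningMax_neg, ← neg_sub', abs_neg] at h

lemma bddAbove_abs_runningMax_sub {x₁ x₂ : ℝ → ℝ} (hc₁ : ContinuousOn x₁ (Set.Ici 0))
    (hc₂ : ContinuousOn x₂ (Set.Ici 0)) (t : ℝ) :
    BddAbove ((fun s => |sSup (x₁ '' Set.Icc 0 s) - sSup (x₂ '' Set.Icc 0 s)|) ''
      Set.Icc 0 t) := by
  refine ⟨max (sSup (x₁ '' Set.Icc 0 t) - x₂ 0) (sSup (x₂ '' Set.Icc 0 t) - x₁ 0), ?_⟩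
  rintro _ ⟨s, hs, rfl⟩
  have a₁ := runningMax_mono hc₁ hs.1 hs.2
  have a₂ := runningMax_mono hc₂ hs.1 hs.2
  have b₁ : x₁ 0 ≤ sSup (x₁ '' Set.Icc 0 s) := le_runningMax hc₁ ⟨le_rfl, hs.1⟩
  have b₂ : x₂ 0 ≤ sSup (x₂ '' Set.Icc 0 s) := le_runningMax hc₂ ⟨le_rfl, hs.1⟩
  exact abs_le'.2 ⟨le_max_of_le_left (by linarith), le_max_of_le_right (by linarith)⟩

lemma abs_add_mul_sub_add_mul_le {a b u v c A B : ℝ} (h : |a - b| ≤ A) (h' : |u - v| ≤ B) :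
    |(a + c * u) - (b + c * v)| ≤ A + |c| * B := by
  calc |(a + c * u) - (b + c * v)| = |(a - b) + c * (u - v)| := by ring_nf
    _ ≤ |a - b| + |c * (u - v)| := abs_add_le _ _
    _ ≤ A + |c| * B := by rw [abs_mul]; gcongr

/-- Under `α < 1`, `β < 1` and `|αβ| < (1−α)(1−β)`, the running maxima
of two continuous solutions of the doubly perturbed path equation satisfy
`(1 − |αβ|/((1−α)(1−β))) · sup_{0≤s≤t} |M¹_s − M²_s|
  ≤ (1/(1−α))·(1 + |β|/(1−β)) · sup_{0≤s≤t} |y¹_s − y²_s|`. -/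
theorem doubly_perturbed_max_contraction_estimate
    (α β : ℝ) (hα : α < 1) (hβ : β < 1)
    (hαβ : |α * β| < (1 - α) * (1 - β))
    (y₁ y₂ : ℝ → ℝ)
    (hy₁ : ContinuousOn y₁ (Set.Ici 0)) (hy₂ : ContinuousOn y₂ (Set.Ici 0))
    (x₁ x₂ : ℝ → ℝ)
    (hx₁_cont : ContinuousOn x₁ (Set.Ici 0)) (hx₂_cont : ContinuousOn x₂ (Set.Ici 0))
    (hx₁ : ∀ t : ℝ, 0 ≤ t →
      x₁ t = y₁ t + α * sSup (x₁ '' Set.Icc 0 t) + β * sInf (x₁ '' Set.Icc 0 t))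
    (hx₂ : ∀ t : ℝ, 0 ≤ t →
      x₂ t = y₂ t + α * sSup (x₂ '' Set.Icc 0 t) + β * sInf (x₂ '' Set.Icc 0 t)) :
    ∀ t : ℝ, 0 ≤ t →
      (1 - |α * β| / ((1 - α) * (1 - β))) *
          sSup ((fun s => |sSup (x₁ '' Set.Icc 0 s) - sSup (x₂ '' Set.Icc 0 s)|) ''
            Set.Icc 0 t) ≤
        (1 / (1 - α)) * (1 + |β| / (1 - β)) *
          sSup ((fun s => |y₁ s - y₂ s|) '' Set.Icc 0 t) := by
  intro t ht
  have hα' : 0 < 1 - α := sub_pos.2 hα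
  have hβ' : 0 < 1 - β := sub_pos.2 hβ
  have hY : ∀ s ∈ Set.Icc 0 t,
      |y₁ s - y₂ s| ≤ sSup ((fun s => |y₁ s - y₂ s|) '' Set.Icc 0 t) :=
    fun s hs => le_runningMax (hy₁.sub hy₂).abs hs
  have hD : ∀ s ∈ Set.Icc 0 t, |sSup (x₁ '' Set.Icc 0 s) - sSup (x₂ '' Set.Icc 0 s)| ≤
      sSup ((fun s => |sSup (x₁ '' Set.Icc 0 s) - sSup (x₂ '' Set.Icc 0 s)|) '' Set.Icc 0 t) :=
    fun s hs => le_csSup (bddAbove_abs_runningMax_sub hx₁_cont hx₂_cont t)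
      (Set.mem_image_of_mem _ hs)
  set Y := sSup ((fun s => |y₁ s - y₂ s|) '' Set.Icc 0 t)
  set D := sSup ((fun s => |sSup (x₁ '' Set.Icc 0 s) - sSup (x₂ '' Set.Icc 0 s)|) ''
    Set.Icc 0 t) with hDdef
  have hI : ∀ s ∈ Set.Icc 0 t, |sInf (x₁ '' Set.Icc 0 s) - sInf (x₂ '' Set.Icc 0 s)| ≤
      (Y + |α| * D) / (1 - β) := fun s hs =>
    abs_runningMin_sub_le hβ hs.1 hx₁_cont hx₂_cont hx₁ hx₂ fun r hr =>
      have hrt : r ∈ Set.Icc 0 t := ⟨hr.1, hr.2.trans hs.2⟩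
      abs_add_mul_sub_add_mul_le (hY r hrt) (hD r hrt)
  have hM : D ≤ (Y + |β| * ((Y + |α| * D) / (1 - β))) / (1 - α) := by
    rw [hDdef]
    refine csSup_le ((Set.nonempty_Icc.2 ht).image _) ?_
    rintro _ ⟨s, hs, rfl⟩
    exact abs_runningMax_sub_le hα hs.1 hx₁_cont hx₂_cont
      (fun r hr => (hx₁ r hr).trans (add_right_comm _ _ _))
      (fun r hr => (hx₂ r hr).trans (add_right_comm _ _ _)) fun r hr =>
        have hrt : r ∈ Set.Icc 0 t := ⟨hr.1, hr.2.trans hs.2⟩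
        abs_add_mul_sub_add_mul_le (hY r hrt) (hI r hrt)
  have hsplit : (Y + |β| * ((Y + |α| * D) / (1 - β))) / (1 - α) =
      1 / (1 - α) * (1 + |β| / (1 - β)) * Y + |α * β| / ((1 - α) * (1 - β)) * D := by
    rw [abs_mul]
    field_simp
    ring
  linarith
end

section
/- Let α < 1 and β < 1 satisfy |αβ| < (1−α)(1−β), and let y : [0,∞) → ℝ be continuous. If x and x' are two continuous functions on [0,∞) both satisfying the doubly perturbed path equation z_t = y_t + α·M^z_t + β·I^z_t for all t ≥ 0 (with z = x and z = x' respectively), then x_t = x'_t for all t ≥ 0. -/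
open Set

/-- Two paths `x = w + α·M` and `x' = w' + α·M'` perturbed at their running maxima: a one-sided
bound between the drivers gives a one-sided bound between the running maxima. -/
theorem perturbed_runningMax_le {α C T : ℝ} (hα : α < 1) {x x' w w' M M' : ℝ → ℝ}
    (hM : ∀ t, 0 ≤ t → IsGreatest (x '' Set.Icc 0 t) (M t))
    (hM' : ∀ t, 0 ≤ t → IsGreatest (x' '' Set.Icc 0 t) (M' t))
    (hx : ∀ t, 0 ≤ t → x t = w t + α * M t)
    (hx' : ∀ t, 0 ≤ t → x' t = w' t + α * M' t)
    (hw : ∀ t ∈ Set.Icc 0 T, w t ≤ w' t + C) :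
    ∀ t ∈ Set.Icc 0 T, (1 - α) * M t ≤ (1 - α) * M' t + C := by
  rintro t ⟨ht0, htT⟩
  obtain ⟨s, ⟨hs0, hst⟩, hs⟩ := (hM t ht0).1
  have hMs : M s = M t := by
    apply le_antisymm
    · exact (hM t ht0).2 (Set.image_mono (Set.Icc_subset_Icc_right hst) (hM s hs0).1)
    · rw [← hs]
      exact (hM s hs0).2 ⟨s, ⟨hs0, le_rfl⟩, rfl⟩
  have hx'M' : x' s ≤ M' s := (hM' s hs0).2 ⟨s, ⟨hs0, le_rfl⟩, rfl⟩
  have hM'mono : M' s ≤ M' t :=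
    (hM' t ht0).2 (Set.image_mono (Set.Icc_subset_Icc_right hst) (hM' s hs0).1)
  have hmul := mul_le_mul_of_nonneg_left hM'mono (sub_nonneg.2 hα.le)
  have hxs := hx s hs0
  have hx's := hx' s hs0
  have hws := hw s ⟨hs0, hst.trans htT⟩
  rw [hMs] at hxs
  linarith

/-- Two-sided version of `perturbed_runningMax_le`. -/
theorem abs_perturbed_runningMax_sub_le {α C T : ℝ} (hα : α < 1) {x x' w w' M M' : ℝ → ℝ}
    (hM : ∀ t, 0 ≤ t → IsGreatest (x '' Set.Icc 0 t) (M t))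
    (hM' : ∀ t, 0 ≤ t → IsGreatest (x' '' Set.Icc 0 t) (M' t))
    (hx : ∀ t, 0 ≤ t → x t = w t + α * M t)
    (hx' : ∀ t, 0 ≤ t → x' t = w' t + α * M' t)
    (hw : ∀ t ∈ Set.Icc 0 T, |w t - w' t| ≤ C) :
    ∀ t ∈ Set.Icc 0 T, (1 - α) * |M t - M' t| ≤ C := by
  intro t ht
  have h₁ := perturbed_runningMax_le (C := C) hα hM hM' hx hx'
    (fun s hs => by linarith [(abs_le.1 (hw s hs)).2]) t ht
  have h₂ := perturbed_runningMax_le (C := C) hα hM' hM hx' hx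
    (fun s hs => by linarith [(abs_le.1 (hw s hs)).1]) t ht
  rw [← abs_of_nonneg (sub_nonneg.2 hα.le), ← abs_mul, abs_le]
  constructor <;> linarith

/-- The analogue of `abs_perturbed_runningMax_sub_le` for running minima. -/
theorem abs_perturbed_runningMin_sub_le {β C T : ℝ} (hβ : β < 1) {x x' w w' I I' : ℝ → ℝ}
    (hI : ∀ t, 0 ≤ t → IsLeast (x '' Set.Icc 0 t) (I t))
    (hI' : ∀ t, 0 ≤ t → IsLeast (x' '' Set.Icc 0 t) (I' t))
    (hx : ∀ t, 0 ≤ t → x t = w t + β * I t)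
    (hx' : ∀ t, 0 ≤ t → x' t = w' t + β * I' t)
    (hw : ∀ t ∈ Set.Icc 0 T, |w t - w' t| ≤ C) :
    ∀ t ∈ Set.Icc 0 T, (1 - β) * |I t - I' t| ≤ C := by
  have isGreatest_neg {z J : ℝ → ℝ} {t : ℝ} (h : IsLeast (z '' Set.Icc 0 t) (J t)) :
      IsGreatest ((fun s => -z s) '' Set.Icc 0 t) (-J t) := by
    obtain ⟨⟨s, hs, hzs⟩, hle⟩ := h
    refine ⟨⟨s, hs, by simp [hzs]⟩, ?_⟩
    rintro _ ⟨r, hr, rfl⟩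
    exact neg_le_neg (hle ⟨r, hr, rfl⟩)
  intro t ht
  have h := abs_perturbed_runningMax_sub_le (w := fun s => -w s) (w' := fun s => -w' s) hβ
    (fun t ht => isGreatest_neg (hI t ht)) (fun t ht => isGreatest_neg (hI' t ht))
    (fun t ht => by linarith [hx t ht]) (fun t ht => by linarith [hx' t ht])
    (fun s hs => by rw [neg_sub_neg, abs_sub_comm]; exact hw s hs) t ht
  rwa [neg_sub_neg, abs_sub_comm] at h

/-- Under `α < 1`, `β < 1` and `|αβ| < (1−α)(1−β)`, the doubly
perturbed path equation `z_t = y_t + α·M^z_t + β·I^z_t` with continuous driver `y`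
admits at most one continuous solution on `[0,∞)`. -/
theorem doubly_perturbed_uniqueness
    (α β : ℝ) (hα : α < 1) (hβ : β < 1)
    (hαβ : |α * β| < (1 - α) * (1 - β))
    (y : ℝ → ℝ) (hy : ContinuousOn y (Set.Ici 0))
    (x x' : ℝ → ℝ)
    (hx_cont : ContinuousOn x (Set.Ici 0)) (hx'_cont : ContinuousOn x' (Set.Ici 0))
    (hx : ∀ t : ℝ, 0 ≤ t →
      x t = y t + α * sSup (x '' Set.Icc 0 t) + β * sInf (x '' Set.Icc 0 t))
    (hx' : ∀ t : ℝ, 0 ≤ t →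
      x' t = y t + α * sSup (x' '' Set.Icc 0 t) + β * sInf (x' '' Set.Icc 0 t)) :
    ∀ t : ℝ, 0 ≤ t → x t = x' t := by
  intro T hT
  have hcompact {z : ℝ → ℝ} (hz : ContinuousOn z (Set.Ici 0)) (t : ℝ) :
      IsCompact (z '' Set.Icc 0 t) :=
    isCompact_Icc.image_of_continuousOn (hz.mono Set.Icc_subset_Ici_self)
  have hne (z : ℝ → ℝ) {t : ℝ} (ht : 0 ≤ t) : (z '' Set.Icc 0 t).Nonempty :=
    (Set.nonempty_Icc.2 ht).image z
  set M : ℝ → ℝ := fun t => sSup (x '' Set.Icc 0 t)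
  set M' : ℝ → ℝ := fun t => sSup (x' '' Set.Icc 0 t)
  set I : ℝ → ℝ := fun t => sInf (x '' Set.Icc 0 t)
  set I' : ℝ → ℝ := fun t => sInf (x' '' Set.Icc 0 t)
  have hM : ∀ t, 0 ≤ t → IsGreatest (x '' Set.Icc 0 t) (M t) :=
    fun t ht => (hcompact hx_cont t).isGreatest_sSup (hne x ht)
  have hM' : ∀ t, 0 ≤ t → IsGreatest (x' '' Set.Icc 0 t) (M' t) :=
    fun t ht => (hcompact hx'_cont t).isGreatest_sSup (hne x' ht)
  have hI : ∀ t, 0 ≤ t → IsLeast (x '' Set.Icc 0 t) (I t) :=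
    fun t ht => (hcompact hx_cont t).isLeast_sInf (hne x ht)
  have hI' : ∀ t, 0 ≤ t → IsLeast (x' '' Set.Icc 0 t) (I' t) :=
    fun t ht => (hcompact hx'_cont t).isLeast_sInf (hne x' ht)
  have hmax {C : ℝ} (hC : ∀ t ∈ Set.Icc 0 T, |I t - I' t| ≤ C) :
      ∀ t ∈ Set.Icc 0 T, (1 - α) * |M t - M' t| ≤ |β| * C :=
    abs_perturbed_runningMax_sub_le (w := fun t => y t + β * I t) (w' := fun t => y t + β * I' t)
      hα hM hM' (fun t ht => by linarith [hx t ht]) (fun t ht => by linarith [hx' t ht])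
      (fun t ht => by
        rw [add_sub_add_left_eq_sub, ← mul_sub, abs_mul]
        exact mul_le_mul_of_nonneg_left (hC t ht) (abs_nonneg β))
  have hmin {C : ℝ} (hC : ∀ t ∈ Set.Icc 0 T, |M t - M' t| ≤ C) :
      ∀ t ∈ Set.Icc 0 T, (1 - β) * |I t - I' t| ≤ |α| * C :=
    abs_perturbed_runningMin_sub_le (w := fun t => y t + α * M t) (w' := fun t => y t + α * M' t)
      hβ hI hI' (fun t ht => by linarith [hx t ht]) (fun t ht => by linarith [hx' t ht])
      (fun t ht => by
        rw [add_sub_add_left_eq_sub, ← mul_sub, abs_mul]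
        exact mul_le_mul_of_nonneg_left (hC t ht) (abs_nonneg α))
  have hα' : 0 < 1 - α := sub_pos.2 hα
  have hβ' : 0 < 1 - β := sub_pos.2 hβ
  set S : Set ℝ := (fun t => |I t - I' t|) '' Set.Icc 0 T
  have hSne : S.Nonempty := hne _ hT
  have hSbdd : BddAbove S := by
    have mem_Icc_of_isLeast {z J : ℝ → ℝ} (hJ : ∀ t, 0 ≤ t → IsLeast (z '' Set.Icc 0 t) (J t)) :
        ∀ t ∈ Set.Icc 0 T, J t ∈ Set.Icc (J T) (z 0) := fun t ht =>
      ⟨(hJ T hT).2 (Set.image_mono (Set.Icc_subset_Icc_right ht.2) (hJ t ht.1).1),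
        (hJ t ht.1).2 ⟨0, ⟨le_rfl, ht.1⟩, rfl⟩⟩
    refine ⟨max (x 0 - I' T) (x' 0 - I T), ?_⟩
    rintro _ ⟨t, ht, rfl⟩
    have h := mem_Icc_of_isLeast hI t ht
    have h' := mem_Icc_of_isLeast hI' t ht
    refine abs_sub_le_iff.2 ⟨le_max_of_le_left ?_, le_max_of_le_right ?_⟩ <;>
      linarith [h.1, h.2, h'.1, h'.2]
  have hS : ∀ t ∈ Set.Icc 0 T, |I t - I' t| ≤ sSup S := fun t ht => le_csSup hSbdd ⟨t, ht, rfl⟩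
  have hMle : ∀ t ∈ Set.Icc 0 T, |M t - M' t| ≤ |β| * sSup S / (1 - α) := fun t ht =>
    (le_div_iff₀' hα').2 (hmax hS t ht)
  have hSle : sSup S ≤ |α| * (|β| * sSup S / (1 - α)) / (1 - β) := by
    refine csSup_le hSne ?_
    rintro _ ⟨t, ht, rfl⟩
    exact (le_div_iff₀' hβ').2 (hmin hMle t ht)
  have hS0 : sSup S ≤ 0 := by
    have hmul : sSup S * ((1 - α) * (1 - β)) ≤ |α * β| * sSup S := by
      calc sSup S * ((1 - α) * (1 - β))
          ≤ |α| * (|β| * sSup S / (1 - α)) / (1 - β) * ((1 - α) * (1 - β)) := by gcongr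
        _ = |α * β| * sSup S := by rw [abs_mul]; field_simp
    by_contra! hpos
    linarith [mul_lt_mul_of_pos_right hαβ hpos]
  have hTT : T ∈ Set.Icc 0 T := ⟨hT, le_rfl⟩
  have hIT : I T = I' T :=
    sub_eq_zero.1 (abs_nonpos_iff.1 ((hS T hTT).trans hS0))
  have hMT : M T = M' T := by
    refine sub_eq_zero.1 (abs_nonpos_iff.1 ((hMle T hTT).trans ?_))
    exact div_nonpos_of_nonpos_of_nonneg
      (mul_nonpos_of_nonneg_of_nonpos (abs_nonneg β) hS0) hα'.le
  have hxT : x T = y T + α * M T + β * I T := hx T hT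
  have hx'T : x' T = y T + α * M' T + β * I' T := hx' T hT
  rw [hxT, hx'T, hIT, hMT]
end

section
/- Let α < 1 and β < 1 satisfy |αβ| < (1−α)(1−β), and let y : [0,∞) → ℝ be continuous. Then there exists a continuous function x : [0,∞) → ℝ satisfying the doubly perturbed path equation x_t = y_t + α·sup_{0≤s≤t} x_s + β·inf_{0≤s≤t} x_s for all t ≥ 0. -/
open Set

/-- The supremum of `f` over the segment from `0` to `t`. -/
noncomputable def segmentSup (f : ℝ → ℝ) (t : ℝ) : ℝ :=
  sSup ((fun u => f (t * u)) '' Icc (0 : ℝ) 1)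

theorem continuous_segmentSup {f : ℝ → ℝ} (hf : Continuous f) : Continuous (segmentSup f) := by
  have h : Continuous (Function.uncurry fun t u : ℝ => f (t * u)) := by
    unfold Function.uncurry
    fun_prop
  exact isCompact_Icc.continuous_sSup h

theorem isGreatest_segmentSup {f : ℝ → ℝ} (hf : Continuous f) (t : ℝ) :
    IsGreatest ((fun u => f (t * u)) '' Icc (0 : ℝ) 1) (segmentSup f t) := by
  have hc : IsCompact ((fun u => f (t * u)) '' Icc (0 : ℝ) 1) :=
    isCompact_Icc.image (by fun_prop)
  exact hc.isGreatest_sSup ((nonempty_Icc.2 zero_le_one).image _)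

theorem le_segmentSup {f : ℝ → ℝ} (hf : Continuous f) (t : ℝ) {u : ℝ} (hu : u ∈ Icc (0 : ℝ) 1) :
    f (t * u) ≤ segmentSup f t :=
  (isGreatest_segmentSup hf t).2 ⟨u, hu, rfl⟩

theorem le_segmentSup_self {f : ℝ → ℝ} (hf : Continuous f) (t : ℝ) : f t ≤ segmentSup f t := by
  simpa using le_segmentSup hf t (right_mem_Icc.2 zero_le_one)

theorem exists_segmentSup_eq {f : ℝ → ℝ} (hf : Continuous f) (t : ℝ) :
    ∃ u ∈ Icc (0 : ℝ) 1, f (t * u) = segmentSup f t :=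
  (isGreatest_segmentSup hf t).1

theorem segmentSup_mul_le {f : ℝ → ℝ} (hf : Continuous f) (t : ℝ) {u : ℝ}
    (hu : u ∈ Icc (0 : ℝ) 1) : segmentSup f (t * u) ≤ segmentSup f t := by
  obtain ⟨v, hv, h⟩ := exists_segmentSup_eq hf (t * u)
  rw [← h, mul_assoc]
  exact le_segmentSup hf t (unitInterval.mul_mem hu hv)

theorem abs_segmentSup_sub_le {f g : ℝ → ℝ} (hf : Continuous f) (hg : Continuous g) {t c : ℝ}
    (h : ∀ u ∈ Icc (0 : ℝ) 1, |f (t * u) - g (t * u)| ≤ c) :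
    |segmentSup f t - segmentSup g t| ≤ c := by
  obtain ⟨u, hu, hfu⟩ := exists_segmentSup_eq hf t
  obtain ⟨v, hv, hgv⟩ := exists_segmentSup_eq hg t
  have h₁ := le_segmentSup hf t hv
  have h₂ := le_segmentSup hg t hu
  have h₃ := abs_le.1 (h u hu)
  have h₄ := abs_le.1 (h v hv)
  rw [abs_le]
  constructor <;> linarith

/-- A causal contraction of the continuous functions on `ℝ` has a fixed point. -/
theorem exists_continuous_fixedPoint {Φ : (ℝ → ℝ) → ℝ → ℝ} {k : ℝ} (hk₀ : 0 ≤ k) (hk₁ : k < 1)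
    (hΦ : ∀ f, Continuous f → Continuous (Φ f))
    (hlip : ∀ f g, Continuous f → Continuous g → ∀ t c,
      (∀ u ∈ Icc (0 : ℝ) 1, |f (t * u) - g (t * u)| ≤ c) → |Φ f t - Φ g t| ≤ k * c) :
    ∃ f, Continuous f ∧ Φ f = f := by
  set F : ℕ → ℝ → ℝ := fun n => Φ^[n] 0
  have hsucc : ∀ n, F (n + 1) = Φ (F n) := fun n => Function.iterate_succ_apply' Φ n 0
  have hcont : ∀ n, Continuous (F n) := by
    intro n
    induction n with
    | zero => exact continuous_const
    | succ n ih => rw [hsucc]; exact hΦ _ ih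
  have hdiff : Continuous fun t => |F 0 t - F 1 t| := ((hcont 0).sub (hcont 1)).abs
  set C : ℝ → ℝ := segmentSup fun t => |F 0 t - F 1 t|
  have hCcont : Continuous C := continuous_segmentSup hdiff
  have hstep : ∀ n t, |F n t - F (n + 1) t| ≤ C t * k ^ n := by
    intro n
    induction n with
    | zero => intro t; simpa using le_segmentSup_self hdiff t
    | succ n ih =>
      intro t
      rw [hsucc (n + 1)]
      nth_rw 1 [hsucc n]
      refine (hlip _ _ (hcont n) (hcont (n + 1)) t (C t * k ^ n) fun u hu => ?_).trans_eq (by ring)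
      exact (ih (t * u)).trans
        (mul_le_mul_of_nonneg_right (segmentSup_mul_le hdiff t hu) (pow_nonneg hk₀ n))
  have hlim : ∀ t, ∃ l, Filter.Tendsto (fun n => F n t) Filter.atTop (nhds l) := fun t =>
    cauchySeq_tendsto_of_complete
      (cauchySeq_of_le_geometric k (C t) hk₁ fun n => by simpa [Real.dist_eq] using hstep n t)
  choose f hf using hlim
  have hdist : ∀ n t, |F n t - f t| ≤ C t * k ^ n / (1 - k) := fun n t => by
    simpa [Real.dist_eq] using dist_le_of_le_geometric_of_tendsto k (C t) hk₁
      (fun n => by simpa [Real.dist_eq] using hstep n t) (hf t) n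
  have hpow : ∀ c : ℝ, Filter.Tendsto (fun n : ℕ => c * k ^ n / (1 - k)) Filter.atTop (nhds 0) := by
    intro c
    simpa using ((tendsto_pow_atTop_nhds_zero_of_lt_one hk₀ hk₁).const_mul c).div_const (1 - k)
  have hfcont : Continuous f := by
    refine TendstoLocallyUniformly.continuous (F := F) (p := Filter.atTop) ?_
      (Filter.Frequently.of_forall hcont)
    rw [Metric.tendstoLocallyUniformly_iff]
    intro ε hε t
    refine ⟨{s | C s < C t + 1}, hCcont.continuousAt.eventually_lt_const (by linarith), ?_⟩
    filter_upwards [(hpow (C t + 1)).eventually_lt_const hε] with n hn s hs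
    rw [dist_comm, Real.dist_eq]
    refine ((hdist n s).trans ?_).trans_lt hn
    have : 0 < 1 - k := by linarith
    have hs' : C s ≤ C t + 1 := le_of_lt hs
    gcongr
  refine ⟨f, hfcont, funext fun t => ?_⟩
  refine tendsto_nhds_unique (f := fun n => F (n + 1) t) (l := Filter.atTop) ?_
    ((hf t).comp (Filter.tendsto_add_atTop_nat 1))
  rw [tendsto_iff_dist_tendsto_zero]
  refine squeeze_zero (fun _ => dist_nonneg) (fun n => ?_)
    (by simpa using (hpow (C t)).const_mul k)
  rw [Real.dist_eq, hsucc]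
  refine hlip _ _ (hcont n) hfcont t _ fun u hu => (hdist n (t * u)).trans ?_
  have : 0 < 1 - k := by linarith
  have := segmentSup_mul_le hdiff t hu
  gcongr

/-- The explicit solution of the singly perturbed equation `x = z + α M^x`. -/
theorem isGreatest_image_singly_perturbed {α : ℝ} (hα : α < 1) {z M : ℝ → ℝ} (hz : Continuous z)
    (hM : ∀ t, (1 - α) * M t = segmentSup z t) {t : ℝ} (ht : 0 ≤ t) :
    IsGreatest ((fun s => z s + α * M s) '' Icc 0 t) (M t) := by
  have hα' : 0 < 1 - α := by linarith
  have hmono : ∀ u ∈ Icc (0 : ℝ) 1, M (t * u) ≤ M t := fun u hu =>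
    le_of_mul_le_mul_left (by rw [hM, hM]; exact segmentSup_mul_le hz t hu) hα'
  constructor
  · obtain ⟨u, hu, h⟩ := exists_segmentSup_eq hz t
    refine ⟨t * u, ⟨mul_nonneg ht hu.1, mul_le_of_le_one_right ht hu.2⟩, ?_⟩
    have hge : M t ≤ M (t * u) := by
      refine le_of_mul_le_mul_left ?_ hα'
      rw [hM, hM, ← h]
      exact le_segmentSup_self hz _
    have heq := le_antisymm (hmono u hu) hge
    have := hM t
    simp only [heq, h]
    linarith
  · rintro _ ⟨s, ⟨hs₀, hst⟩, rfl⟩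
    have hs : M s ≤ M t := by
      rcases ht.eq_or_lt with rfl | ht'
      · rw [le_antisymm hst hs₀]
      · have := hmono (s / t) ⟨by positivity, (div_le_one ht').2 hst⟩
        rwa [mul_div_cancel₀ s ht'.ne'] at this
    have := hM s
    have := le_segmentSup_self hz s
    simp only
    linarith

/-- Under `α < 1`, `β < 1` and `|αβ| < (1−α)(1−β)`, for every
continuous driver `y` on `[0,∞)` there exists a continuous solution of the doubly
perturbed path equation `x_t = y_t + α·sup_{0≤s≤t} x_s + β·inf_{0≤s≤t} x_s`. -/
theorem doubly_perturbed_existence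
    (α β : ℝ) (hα : α < 1) (hβ : β < 1)
    (hαβ : |α * β| < (1 - α) * (1 - β))
    (y : ℝ → ℝ) (hy : ContinuousOn y (Set.Ici 0)) :
    ∃ x : ℝ → ℝ, ContinuousOn x (Set.Ici 0) ∧
      ∀ t : ℝ, 0 ≤ t →
        x t = y t + α * sSup (x '' Set.Icc 0 t) + β * sInf (x '' Set.Icc 0 t) := by
  have hα' : 0 < 1 - α := by linarith
  have hβ' : 0 < 1 - β := by linarith
  set Y : ℝ → ℝ := fun t => y (max t 0)
  have hY : Continuous Y :=
    hy.comp_continuous (continuous_id.max continuous_const) fun t => le_max_right t 0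
  have hYy : ∀ t, 0 ≤ t → Y t = y t := fun t ht => congrArg y (max_eq_left ht)
  -- `J M` is the negative of the running minimum determined by the running maximum `M`.
  set J : (ℝ → ℝ) → ℝ → ℝ := fun M t => (1 - β)⁻¹ * segmentSup (fun s => -(Y s + α * M s)) t
    with hJ
  set Φ : (ℝ → ℝ) → ℝ → ℝ := fun M t => (1 - α)⁻¹ * segmentSup (fun s => Y s - β * J M s) t
    with hΦ
  have hJcont : ∀ M, Continuous M → Continuous (J M) := fun M hM =>
    continuous_const.mul (continuous_segmentSup (by fun_prop))
  have hzcont : ∀ M, Continuous M → Continuous fun s => Y s - β * J M s := fun M hM =>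
    hY.sub (continuous_const.mul (hJcont M hM))
  have hJlip : ∀ f g, Continuous f → Continuous g → ∀ t c,
      (∀ u ∈ Icc (0 : ℝ) 1, |f (t * u) - g (t * u)| ≤ c) →
        |J f t - J g t| ≤ (1 - β)⁻¹ * (|α| * c) := by
    intro f g hf hg t c h
    simp only [hJ]
    rw [← mul_sub, abs_mul, abs_of_pos (inv_pos.2 hβ')]
    refine mul_le_mul_of_nonneg_left ?_ (inv_pos.2 hβ').le
    refine abs_segmentSup_sub_le (by fun_prop) (by fun_prop) fun u hu => ?_
    rw [show -(Y (t * u) + α * f (t * u)) - -(Y (t * u) + α * g (t * u))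
      = -(α * (f (t * u) - g (t * u))) by ring, abs_neg, abs_mul]
    exact mul_le_mul_of_nonneg_left (h u hu) (abs_nonneg α)
  obtain ⟨M, hMcont, hM⟩ := exists_continuous_fixedPoint (Φ := Φ)
    (k := |α * β| / ((1 - α) * (1 - β))) (by positivity) ((div_lt_one (by positivity)).2 hαβ)
    (fun M hM => continuous_const.mul (continuous_segmentSup (hzcont M hM))) (by
      intro f g hf hg t c h
      have hbound : |Φ f t - Φ g t| ≤ (1 - α)⁻¹ * (|β| * ((1 - β)⁻¹ * (|α| * c))) := by
        simp only [hΦ]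
        rw [← mul_sub, abs_mul, abs_of_pos (inv_pos.2 hα')]
        refine mul_le_mul_of_nonneg_left ?_ (inv_pos.2 hα').le
        refine abs_segmentSup_sub_le (hzcont f hf) (hzcont g hg) fun u hu => ?_
        rw [show Y (t * u) - β * J f (t * u) - (Y (t * u) - β * J g (t * u))
          = -(β * (J f (t * u) - J g (t * u))) by ring, abs_neg, abs_mul]
        refine mul_le_mul_of_nonneg_left (hJlip f g hf hg _ c fun v hv => ?_) (abs_nonneg β)
        rw [mul_assoc]
        exact h _ (unitInterval.mul_mem hu hv)
      refine hbound.trans_eq ?_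
      rw [abs_mul]
      field_simp)
  set x : ℝ → ℝ := fun t => Y t + α * M t - β * J M t with hx
  have hsup : ∀ t, 0 ≤ t → sSup (x '' Icc 0 t) = M t := by
    intro t ht
    have h := isGreatest_image_singly_perturbed hα (hzcont M hMcont) (M := M) (fun t => by
      nth_rw 1 [← hM]
      exact mul_inv_cancel_left₀ hα'.ne' _) ht
    rw [show (fun s => Y s - β * J M s + α * M s) = x by funext s; simp only [hx]; ring] at h
    exact h.csSup_eq
  have hinf : ∀ t, 0 ≤ t → sInf (x '' Icc 0 t) = -J M t := by
    intro t ht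
    have h := isGreatest_image_singly_perturbed hβ (z := fun s => -(Y s + α * M s)) (M := J M)
      (by fun_prop) (fun t => mul_inv_cancel_left₀ hβ'.ne' _) ht
    rw [show (fun s => -(Y s + α * M s) + β * J M s) = fun s => -x s by
      funext s; simp only [hx]; ring] at h
    refine IsLeast.csInf_eq ⟨?_, ?_⟩
    · obtain ⟨s, hs, hsx⟩ := h.1
      exact ⟨s, hs, by rw [← hsx, neg_neg]⟩
    · rintro _ ⟨s, hs, rfl⟩
      exact neg_le.1 (h.2 ⟨s, hs, rfl⟩)
  refine ⟨x, ((hY.add (continuous_const.mul hMcont)).sub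
    (continuous_const.mul (hJcont M hMcont))).continuousOn, fun t ht => ?_⟩
  rw [hsup t ht, hinf t ht, ← hYy t ht]
  simp only [hx]
  ring
end

section
/- Let H : ℝ → ℝ be monotone increasing and Lipschitz with some constant k < 1, i.e. |H(a) − H(b)| ≤ k·|a − b| for all a, b ∈ ℝ. Then for every continuous function y : [0,∞) → ℝ there exists a unique continuous function x : [0,∞) → ℝ satisfying x_t = y_t + H( sup_{0≤s≤t} x_s ) for all t ≥ 0. -/
open Set

/-- The running maximum of a function continuous on `[0,∞)` is continuous on `[0,∞)`. -/
lemma ContinuousOn.sSup_image_Icc {y : ℝ → ℝ} (hy : ContinuousOn y (Ici 0)) :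
    ContinuousOn (fun t => sSup (y '' Icc 0 t)) (Ici 0) := by
  have hc : Continuous fun p : ℝ × ℝ => y (max 0 (p.2 * p.1)) :=
    hy.comp_continuous (by fun_prop) fun p => mem_Ici.2 (le_max_left _ _)
  have hs : Continuous fun t : ℝ => sSup ((fun s => y (max 0 (s * t))) '' Icc 0 1) :=
    isCompact_Icc.continuous_sSup (f := fun t s : ℝ => y (max 0 (s * t))) hc
  refine hs.continuousOn.congr fun t (ht : 0 ≤ t) => ?_
  have himage : y '' Icc 0 t = (fun s => y (max 0 (s * t))) '' Icc 0 1 := by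
    ext v
    constructor
    · rintro ⟨s, ⟨hs0, hst⟩, rfl⟩
      refine ⟨s / t, ⟨by positivity, div_le_one_of_le₀ hst ht⟩, ?_⟩
      rcases ht.eq_or_lt with rfl | ht
      · simp [le_antisymm hst hs0]
      · simp only
        rw [div_mul_cancel₀ _ ht.ne', max_eq_right hs0]
    · rintro ⟨s, ⟨hs0, hs1⟩, rfl⟩
      have hst : 0 ≤ s * t := by positivity
      exact ⟨s * t, ⟨hst, mul_le_of_le_one_left ht hs1⟩, by simp only [max_eq_right hst]⟩
  simp only [himage]

/-- The running maximum of a function continuous on `[0,∞)` is attained. -/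
lemma ContinuousOn.isGreatest_sSup_image_Icc {x : ℝ → ℝ} (hx : ContinuousOn x (Ici 0))
    {t : ℝ} (ht : 0 ≤ t) : IsGreatest (x '' Icc 0 t) (sSup (x '' Icc 0 t)) :=
  (isCompact_Icc.image_of_continuousOn (hx.mono Icc_subset_Ici_self)).isGreatest_sSup
    ((nonempty_Icc.2 ht).image x)

/-- If `H` is Lipschitz with constant `k < 1`, then `u ↦ u - H u` is an increasing bijection
of the real line. -/
lemma exists_orderIso_sub_of_lipschitz {H : ℝ → ℝ} {k : ℝ} (hk : k < 1)
    (hH : ∀ a b : ℝ, |H a - H b| ≤ k * |a - b|) :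
    ∃ e : ℝ ≃o ℝ, ∀ u, e u = u - H u := by
  have hHc : Continuous H := (LipschitzWith.of_dist_le' hH).continuous
  have hgrow : ∀ a b : ℝ, a ≤ b → (1 - k) * (b - a) ≤ (b - H b) - (a - H a) := by
    intro a b hab
    have h := (le_abs_self _).trans (hH b a)
    rw [abs_of_nonneg (sub_nonneg.2 hab)] at h
    linarith
  have hmono : StrictMono fun u => u - H u := by
    intro a b hab
    have h := hgrow a b hab.le
    have : 0 < (1 - k) * (b - a) := mul_pos (by linarith) (by linarith)
    simp only
    linarith
  have hsurj : Function.Surjective fun u => u - H u := by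
    refine Continuous.surjective (by fun_prop) ?_ ?_
    · refine Filter.tendsto_atTop_mono' _ (f₁ := fun u => (1 - k) * u + (0 - H 0)) ?_ ?_
      · filter_upwards [Filter.eventually_ge_atTop 0] with u hu
        have := hgrow 0 u hu
        linarith
      · exact Filter.tendsto_atTop_add_const_right _ _
          (Filter.tendsto_id.const_mul_atTop (by linarith))
    · refine Filter.tendsto_atBot_mono' _ (f₁ := fun u => (1 - k) * u + (0 - H 0)) ?_ ?_
      · filter_upwards [Filter.eventually_le_atBot 0] with u hu
        have := hgrow u 0 hu
        linarith
      · exact Filter.tendsto_atBot_add_const_right _ _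
          (Filter.tendsto_id.const_mul_atBot (by linarith))
  exact ⟨hmono.orderIsoOfSurjective _ hsurj, fun u => rfl⟩

/-- For a continuous solution `x` of the perturbed equation, the running maximum of the driver is
the image of the running maximum of `x` under `u ↦ u - H u`. -/
lemma orderIso_sSup_image_Icc_eq {H x y : ℝ → ℝ} (e : ℝ ≃o ℝ) (he : ∀ u, e u = u - H u)
    (hx : ContinuousOn x (Ici 0))
    (hxy : ∀ t : ℝ, 0 ≤ t → x t = y t + H (sSup (x '' Icc 0 t))) {t : ℝ} (ht : 0 ≤ t) :
    e (sSup (x '' Icc 0 t)) = sSup (y '' Icc 0 t) := by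
  refine (IsGreatest.csSup_eq ⟨?_, ?_⟩).symm
  · obtain ⟨s, ⟨hs0, hst⟩, hs⟩ := (hx.isGreatest_sSup_image_Icc ht).1
    have hM : sSup (x '' Icc 0 s) = sSup (x '' Icc 0 t) := by
      refine IsGreatest.csSup_eq ⟨⟨s, ⟨hs0, le_rfl⟩, hs⟩, fun v hv => ?_⟩
      exact (hx.isGreatest_sSup_image_Icc ht).2 (image_mono (Icc_subset_Icc_right hst) hv)
    refine ⟨s, ⟨hs0, hst⟩, ?_⟩
    have := hxy s hs0
    rw [hM] at this
    rw [he]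
    linarith
  · rintro _ ⟨s, ⟨hs0, hst⟩, rfl⟩
    have hs := hx.isGreatest_sSup_image_Icc hs0
    have hM : sSup (x '' Icc 0 s) ≤ sSup (x '' Icc 0 t) :=
      (hx.isGreatest_sSup_image_Icc ht).2 (image_mono (Icc_subset_Icc_right hst) hs.1)
    refine le_trans ?_ (e.monotone hM)
    have h1 := hs.2 ⟨s, ⟨hs0, le_rfl⟩, rfl⟩
    have h2 := hxy s hs0
    rw [he]
    linarith

/-- If `H : ℝ → ℝ` is monotone increasing and Lipschitz with a constant
`k < 1`, then for every continuous driver `y` on `[0,∞)` there is a unique continuous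
solution of the `H`-perturbed path equation `x_t = y_t + H(sup_{0≤s≤t} x_s)`. -/
theorem H_perturbed_existence_uniqueness
    (H : ℝ → ℝ) (hH_mono : Monotone H)
    (k : ℝ) (hk : k < 1)
    (hH_lip : ∀ a b : ℝ, |H a - H b| ≤ k * |a - b|)
    (y : ℝ → ℝ) (hy : ContinuousOn y (Set.Ici 0)) :
    ∃ x : ℝ → ℝ,
      (ContinuousOn x (Set.Ici 0) ∧
        ∀ t : ℝ, 0 ≤ t → x t = y t + H (sSup (x '' Set.Icc 0 t))) ∧
      ∀ x' : ℝ → ℝ,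
        (ContinuousOn x' (Set.Ici 0) ∧
          ∀ t : ℝ, 0 ≤ t → x' t = y t + H (sSup (x' '' Set.Icc 0 t))) →
        ∀ t : ℝ, 0 ≤ t → x' t = x t := by
  obtain ⟨e, he⟩ := exists_orderIso_sub_of_lipschitz hk hH_lip
  have hHc : Continuous H := (LipschitzWith.of_dist_le' hH_lip).continuous
  refine ⟨fun t => y t + H (e.symm (sSup (y '' Icc 0 t))), ⟨?_, fun t ht => ?_⟩, ?_⟩
  · exact hy.add ((hHc.comp e.symm.continuous).comp_continuousOn hy.sSup_image_Icc)
  · have hHe : ∀ v, H (e.symm v) = e.symm v - v := by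
      intro v
      have := he (e.symm v)
      rw [e.apply_symm_apply] at this
      linarith
    have hyt := hy.isGreatest_sSup_image_Icc ht
    have hM : sSup ((fun t => y t + H (e.symm (sSup (y '' Icc 0 t)))) '' Icc 0 t) =
        e.symm (sSup (y '' Icc 0 t)) := by
      refine IsGreatest.csSup_eq ⟨?_, ?_⟩
      · obtain ⟨s, ⟨hs0, hst⟩, hs⟩ := hyt.1
        have hMs : sSup (y '' Icc 0 s) = sSup (y '' Icc 0 t) :=
          IsGreatest.csSup_eq ⟨⟨s, ⟨hs0, le_rfl⟩, hs⟩,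
            fun v hv => hyt.2 (image_mono (Icc_subset_Icc_right hst) hv)⟩
        refine ⟨s, ⟨hs0, hst⟩, ?_⟩
        simp only [hMs, hHe, hs]
        ring
      · rintro _ ⟨s, ⟨hs0, hst⟩, rfl⟩
        have hys := hy.isGreatest_sSup_image_Icc hs0
        have h1 := hys.2 ⟨s, ⟨hs0, le_rfl⟩, rfl⟩
        have h2 := e.symm.monotone (hyt.2 (image_mono (Icc_subset_Icc_right hst) hys.1))
        simp only [hHe]
        linarith
    rw [hM]
  · rintro x' ⟨hx', hxy⟩ t ht
    simp only
    rw [hxy t ht, ← orderIso_sSup_image_Icc_eq e he hx' hxy ht, e.symm_apply_apply]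
end

section
/- Let H : ℝ → ℝ be monotone increasing and Lipschitz with some constant k < 1, let y : [0,∞) → ℝ be continuous, and let x : [0,∞) → ℝ be a continuous function satisfying x_t = y_t + H( sup_{0≤s≤t} x_s ) for all t ≥ 0. Then for every t ≥ 0, the running maximum m(t) = sup_{0≤s≤t} x_s is the unique real number m satisfying m = sup_{0≤s≤t} y_s + H(m); in particular t ↦ m(t) is the unique fixed point of the contraction m ↦ M^y_t + H(m) for each t. -/
open Set

/-- If `x` is a continuous solution on `[0,∞)` of the `H`-perturbed
path equation `x_t = y_t + H(sup_{0≤s≤t} x_s)` with `H` monotone increasing and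
Lipschitz with constant `k < 1`, then for each `t ≥ 0` the running maximum
`m(t) = sup_{0≤s≤t} x_s` is the unique real number `m` with `m = sup_{0≤s≤t} y_s + H(m)`,
i.e. the unique fixed point of the contraction `m ↦ M^y_t + H(m)`. -/
theorem H_perturbed_running_max_fixed_point
    (H : ℝ → ℝ) (hH_mono : Monotone H)
    (k : ℝ) (hk : k < 1)
    (hH_lip : ∀ a b : ℝ, |H a - H b| ≤ k * |a - b|)
    (y : ℝ → ℝ) (hy : ContinuousOn y (Set.Ici 0))
    (x : ℝ → ℝ) (hx_cont : ContinuousOn x (Set.Ici 0))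
    (hx : ∀ t : ℝ, 0 ≤ t → x t = y t + H (sSup (x '' Set.Icc 0 t))) :
    ∀ t : ℝ, 0 ≤ t →
      (sSup (x '' Set.Icc 0 t) = sSup (y '' Set.Icc 0 t) + H (sSup (x '' Set.Icc 0 t))) ∧
      ∀ m : ℝ, m = sSup (y '' Set.Icc 0 t) + H m → m = sSup (x '' Set.Icc 0 t) := by
  intro t ht
  have hne : (Icc 0 t).Nonempty := ⟨0, le_rfl, ht⟩
  have hx_bdd {r : ℝ} : BddAbove (x '' Icc 0 r) :=
    isCompact_Icc.bddAbove_image (hx_cont.mono Icc_subset_Ici_self)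
  have hy_cont : ContinuousOn y (Icc 0 t) := hy.mono Icc_subset_Ici_self
  have hmono {r : ℝ} (hr : r ∈ Icc 0 t) : sSup (x '' Icc 0 r) ≤ sSup (x '' Icc 0 t) :=
    csSup_le_csSup hx_bdd ⟨x 0, 0, ⟨le_rfl, hr.1⟩, rfl⟩
      (image_mono (Icc_subset_Icc_right hr.2))
  have hle_sSup {r : ℝ} (hr : 0 ≤ r) : x r ≤ sSup (x '' Icc 0 r) :=
    le_csSup hx_bdd ⟨r, ⟨hr, le_rfl⟩, rfl⟩
  have hfix : sSup (x '' Icc 0 t) = sSup (y '' Icc 0 t) + H (sSup (x '' Icc 0 t)) := by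
    apply le_antisymm
    · obtain ⟨s, hs, hs_max⟩ := isCompact_Icc.exists_sSup_image_eq hne
        (hx_cont.mono Icc_subset_Ici_self)
      have hs_eq : sSup (x '' Icc 0 s) = sSup (x '' Icc 0 t) :=
        le_antisymm (hmono hs) (hs_max.trans_le (hle_sSup hs.1))
      have hxs := hx s hs.1
      rw [hs_eq, ← hs_max] at hxs
      have hys : y s ≤ sSup (y '' Icc 0 t) :=
        le_csSup (isCompact_Icc.bddAbove_image hy_cont) ⟨s, hs, rfl⟩
      linarith
    · obtain ⟨u, hu, hu_max⟩ := isCompact_Icc.exists_sSup_image_eq hne hy_cont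
      have hxu := hx u hu.1
      have hxu_le := hle_sSup hu.1
      have hu_le := hmono hu
      have hlip := (le_abs_self _).trans
        (hH_lip (sSup (x '' Icc 0 t)) (sSup (x '' Icc 0 u)))
      rw [abs_of_nonneg (sub_nonneg.2 hu_le)] at hlip
      nlinarith
  refine ⟨hfix, fun m hm => ?_⟩
  have hlip := hH_lip m (sSup (x '' Icc 0 t))
  rw [show H m - H (sSup (x '' Icc 0 t)) = m - sSup (x '' Icc 0 t) by linarith] at hlip
  have habs : |m - sSup (x '' Icc 0 t)| ≤ 0 := by
    nlinarith [abs_nonneg (m - sSup (x '' Icc 0 t))]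
  exact sub_eq_zero.1 (abs_nonpos_iff.1 habs)
end
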